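/- Fix a constant c > 0. There is a constant ε' > 0 such that for every sufficiently large k and every c-Ramsey graph G on n = 2^k vertices, every resolution refutation of the CNF Clique(G) has length at least 2^{ε'·k²}, which is n^{Ω(log₂ n)}. -/

import Mathlib

open Classical
noncomputable section

/-- A clause: a finite set of literals, where a literal is a pair (variable, polarity). -/
abbrev Clause (V : Type) := Finset (V × Bool)

/-- A literal `(x, b)` is satisfied by assignment `a` iff `a x = b`. -/
def litSat {V : Type} (a : V → Bool) (l : V × Bool) : Prop := a l.1 = l.2

/-- A clause is satisfied if some literal in it is satisfied. -/
def clauseSat {V : Type} (a : V → Bool) (C : Clause V) : Prop := ∃ l ∈ C, litSat a l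

/-- A CNF formula: a set of clauses. -/
abbrev CNF (V : Type) := Set (Clause V)

/-- A CNF is satisfiable if some assignment satisfies all its clauses. -/
def Satisfiable {V : Type} (φ : CNF V) : Prop := ∃ a : V → Bool, ∀ C ∈ φ, clauseSat a C

/-- A resolution refutation of a CNF `φ`: a sequence of clauses, each either a clause of `φ`
or obtained from two earlier clauses `A ∨ x`, `B ∨ ¬x` by the resolution rule (yielding
`A ∨ B`), ending with the empty clause. -/
structure Refutation {V : Type} [DecidableEq V] (φ : CNF V) where
  clauses : List (Clause V)
  nonempty : clauses ≠ []
  valid : ∀ i : Fin clauses.length, clauses.get i ∈ φ ∨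
    ∃ j k : Fin clauses.length, j < i ∧ k < i ∧
      ∃ (x : V) (A B : Clause V),
        clauses.get j = insert (x, true) A ∧
        clauses.get k = insert (x, false) B ∧
        clauses.get i = A ∪ B
  last_empty : clauses.getLast nonempty = ∅

/-- The length of a refutation: the number of clauses in the sequence. -/
def Refutation.length {V : Type} [DecidableEq V] {φ : CNF V} (R : Refutation φ) : ℕ :=
  R.clauses.length

/-- The width of a refutation: the maximum width (number of literals) of a clause in it. -/
def Refutation.width {V : Type} [DecidableEq V] {φ : CNF V} (R : Refutation φ) : ℕ :=
  (R.clauses.map Finset.card).foldr max 0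

/-- `L(φ)`: minimum length of a resolution refutation of `φ` (`⊤` if none exists,
in particular if `φ` is satisfiable). -/
def resLength {V : Type} [DecidableEq V] (φ : CNF V) : ℕ∞ :=
  sInf {l : ℕ∞ | ∃ R : Refutation φ, (R.length : ℕ∞) = l}

/-- `W(φ)`: minimum over refutations of the maximum clause width. -/
def resWidth {V : Type} [DecidableEq V] (φ : CNF V) : ℕ :=
  sInf {w : ℕ | ∃ R : Refutation φ, R.width = w}

/-- Treelike resolution derivations of a clause from the clauses of `φ`. -/
inductive ResTree {V : Type} [DecidableEq V] (φ : CNF V) : Clause V → Type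
  | ax (C : Clause V) (h : C ∈ φ) : ResTree φ C
  | res (x : V) (A B : Clause V) :
      ResTree φ (insert (x, true) A) → ResTree φ (insert (x, false) B) → ResTree φ (A ∪ B)

/-- The length (number of clauses, i.e. nodes) of a treelike derivation. -/
def ResTree.size {V : Type} [DecidableEq V] {φ : CNF V} {C : Clause V} : ResTree φ C → ℕ
  | .ax _ _ => 1
  | .res _ _ _ t₁ t₂ => t₁.size + t₂.size + 1

/-! ### The Prover–Adversary game -/

/-- A Prover move: query a variable, or erase (forget) a stored value. -/
inductive PMove (V : Type)
  | query (x : V)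
  | forget (x : V)

/-- A history of the game: list of moves (most recent first) together with the
Adversary's answer for query moves. -/
abbrev History (V : Type) := List (PMove V × Option Bool)

/-- A Prover strategy: choose the next move given the history so far. -/
def ProverStrat (V : Type) := History V → PMove V

/-- An Adversary strategy: answer a queried variable, given the history so far. -/
def AdvStrat (V : Type) := History V → V → Bool

/-- The stored partial assignment (memory content) determined by a history. -/
def memOf {V : Type} [DecidableEq V] : History V → V → Option Bool
  | [] => fun _ => none
  | (PMove.query x, ans) :: h => Function.update (memOf h) x ans
  | (PMove.forget x, _) :: h => Function.update (memOf h) x none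

/-- The history after `t` rounds of play between strategies `P` and `A`. -/
def play {V : Type} (P : ProverStrat V) (A : AdvStrat V) : ℕ → History V
  | 0 => []
  | t + 1 =>
    let h := play P A t
    match P h with
    | PMove.query x => (PMove.query x, some (A h x)) :: h
    | PMove.forget x => (PMove.forget x, none) :: h

/-- Number of memory locations in use: number of variables with a stored value. -/
def memSize {V : Type} [Fintype V] [DecidableEq V] (h : History V) : ℕ :=
  (Finset.univ.filter fun x => (memOf h x).isSome).card

/-- The stored partial assignment falsifies clause `C`: every literal of `C` is
assigned and falsified. -/
def falsifies {V : Type} [DecidableEq V] (h : History V) (C : Clause V) : Prop :=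
  ∀ l ∈ C, memOf h l.1 = some (!l.2)

/-- The Prover has a strategy winning the game on `φ` while never storing more than `M`
values: against every Adversary, the memory stays within `M` and at some point the
stored partial assignment falsifies a clause of `φ`. -/
def ProverWinsWith {V : Type} [Fintype V] [DecidableEq V] (φ : CNF V) (M : ℝ) : Prop :=
  ∃ P : ProverStrat V, ∀ A : AdvStrat V,
    (∀ t, (memSize (play P A t) : ℝ) ≤ M) ∧ ∃ t, ∃ C ∈ φ, falsifies (play P A t) C

/-- The Adversary has a strategy winning against every Prover who uses at most `M`
memory locations: whenever the play keeps the memory within `M`, no clause of `φ` is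
ever falsified. -/
def AdversaryWinsAgainst {V : Type} [Fintype V] [DecidableEq V] (φ : CNF V) (M : ℝ) : Prop :=
  ∃ A : AdvStrat V, ∀ P : ProverStrat V,
    (∀ t, (memSize (play P A t) : ℝ) ≤ M) → ∀ t, ∀ C ∈ φ, ¬ falsifies (play P A t) C

/-! ### Ramsey graphs and the formulas `Ψ_G`, `Clique(G)` -/

/-- A graph on `n` vertices is `c`-Ramsey if no set of `c·log₂ n` vertices forms a clique
or an independent set. -/
def IsCRamsey (c : ℝ) {n : ℕ} (G : SimpleGraph (Fin n)) : Prop :=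
  ¬ ∃ T : Finset (Fin n), T.card = ⌈c * Real.logb 2 n⌉₊ ∧
      (G.IsClique (T : Set (Fin n)) ∨ Gᶜ.IsClique (T : Set (Fin n)))

/-- The number `ck` of indices. -/
def numIdx (c : ℝ) (k : ℕ) : ℕ := ⌈c * (k : ℕ)⌉₊

/-- Variables of the formula `Clique(G)`: bit `b` of the vertex assigned to index `i`. -/
abbrev CliqueVar (c : ℝ) (k : ℕ) := Fin (numIdx c k) × Fin k

/-- Variables of `Ψ_G`: the bit variables `x^i_b` together with the extra variable `y`. -/
abbrev PsiVar (c : ℝ) (k : ℕ) := CliqueVar c k ⊕ Unit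

/-- Bit `b` of the binary representation of vertex `v`. -/
def vbit {k : ℕ} (v : Fin (2 ^ k)) (b : Fin k) : Bool := Nat.testBit v.val b.val

/-- The clause `⋁_b (x^i_b ≠ v_b)`, saying that index `i` is not mapped to vertex `v`. -/
def neqClause (c : ℝ) (k : ℕ) (i : Fin (numIdx c k)) (v : Fin (2 ^ k)) :
    Clause (CliqueVar c k) :=
  Finset.univ.image fun b : Fin k => (((i, b) : CliqueVar c k), ! vbit v b)

/-- The CNF `Clique(G)`: injectivity clauses, plus for each non-edge `{u,v}` and distinct
indices `i,j` the clause `⋁_b (x^i_b ≠ u_b) ∨ ⋁_b (x^j_b ≠ v_b)`.  It is satisfiable iff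
`G` has a clique of size `ck`. -/
def CliqueCNF (c : ℝ) {k : ℕ} (G : SimpleGraph (Fin (2 ^ k))) : CNF (CliqueVar c k) :=
  {C | (∃ i j : Fin (numIdx c k), i ≠ j ∧ ∃ v : Fin (2 ^ k),
          C = neqClause c k i v ∪ neqClause c k j v) ∨
       (∃ i j : Fin (numIdx c k), i ≠ j ∧ ∃ u v : Fin (2 ^ k), u ≠ v ∧ ¬ G.Adj u v ∧
          C = neqClause c k i u ∪ neqClause c k j v)}

/-- Lift a clause on the bit variables to the variable set of `Ψ_G`. -/
def liftClause {c : ℝ} {k : ℕ} (C : Clause (CliqueVar c k)) : Clause (PsiVar c k) :=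
  C.image fun l => (Sum.inl l.1, l.2)

/-- The CNF `Ψ_G`: (1) injectivity clauses; (2) for each edge `{u,v}` and distinct `i,j`
the clause `y ∨ ⋁_b (x^i_b ≠ u_b) ∨ ⋁_b (x^j_b ≠ v_b)`; (3) for each non-edge `{u,v}` and
distinct `i,j` the clause `¬y ∨ ⋁_b (x^i_b ≠ u_b) ∨ ⋁_b (x^j_b ≠ v_b)`. -/
def PsiCNF (c : ℝ) {k : ℕ} (G : SimpleGraph (Fin (2 ^ k))) : CNF (PsiVar c k) :=
  {C | (∃ i j : Fin (numIdx c k), i ≠ j ∧ ∃ v : Fin (2 ^ k),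
          C = liftClause (neqClause c k i v ∪ neqClause c k j v)) ∨
       (∃ i j : Fin (numIdx c k), i ≠ j ∧ ∃ u v : Fin (2 ^ k), G.Adj u v ∧
          C = insert (Sum.inr (), true)
                (liftClause (neqClause c k i u ∪ neqClause c k j v))) ∨
       (∃ i j : Fin (numIdx c k), i ≠ j ∧ ∃ u v : Fin (2 ^ k), u ≠ v ∧ ¬ G.Adj u v ∧
          C = insert (Sum.inr (), false)
                (liftClause (neqClause c k i u ∪ neqClause c k j v)))}

/-! ### Property P, density, probability -/

/-- Property P: for every `U ⊆ V(G)` with `|U| ≤ k/3` and every pattern `p` with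
`|p| ≤ k/3`, some common neighbour of `U` is consistent with `p`.  A pattern is a partial
assignment `p : Fin k → Option Bool` of the `k` bits; its size is the number of assigned
bits. -/
def PropertyP {k : ℕ} (G : SimpleGraph (Fin (2 ^ k))) : Prop :=
  ∀ U : Finset (Fin (2 ^ k)), 3 * U.card ≤ k →
    ∀ p : Fin k → Option Bool, 3 * (Finset.univ.filter fun b => (p b).isSome).card ≤ k →
      ∃ v : Fin (2 ^ k), (∀ u ∈ U, G.Adj u v) ∧
        ∀ (b : Fin k) (bit : Bool), p b = some bit → vbit v b = bit

/-- The mutual density `d(A,B) = e(A,B)/(|A|·|B|)`, where `e(A,B)` is the number of pairs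
`(a,b) ∈ A × B` with `{a,b}` an edge. -/
def density {α : Type} (G : SimpleGraph α) (A B : Finset α) : ℝ :=
  (((A ×ˢ B).filter fun ab => G.Adj ab.1 ab.2).card : ℝ) / ((A.card : ℝ) * (B.card : ℝ))

/-- The probability of the event `P` under the uniform distribution on a finite type;
the uniform distribution on `SimpleGraph (Fin n)` is exactly `G(n, 1/2)`. -/
def probOf {α : Type} [Fintype α] (P : α → Prop) : ℝ :=
  ((Finset.univ.filter P).card : ℝ) / (Fintype.card α : ℝ)

/-! ### The unary formula `Ψ'_G` -/

/-- Variables of the unary formula `Ψ'_G`: variables `p^i_v` for `i ∈ [c·log₂ n]`,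
`v ∈ V(G)`, plus the extra variable `y`. -/
abbrev UnaryVar (c : ℝ) (n : ℕ) := (Fin ⌈c * Real.logb 2 n⌉₊ × Fin n) ⊕ Unit

/-- The unary CNF `Ψ'_G`: each index is mapped to exactly one vertex, the map is
injective, and (depending on `y`) the image is a clique or an independent set. -/
def PsiUnary (c : ℝ) {n : ℕ} (G : SimpleGraph (Fin n)) : CNF (UnaryVar c n) :=
  {C | (∃ i : Fin ⌈c * Real.logb 2 n⌉₊,
          C = Finset.univ.image fun v : Fin n => ((Sum.inl (i, v) : UnaryVar c n), true)) ∨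
       (∃ i : Fin ⌈c * Real.logb 2 n⌉₊, ∃ u v : Fin n, u ≠ v ∧
          C = {((Sum.inl (i, u) : UnaryVar c n), false), (Sum.inl (i, v), false)}) ∨
       (∃ i j : Fin ⌈c * Real.logb 2 n⌉₊, i ≠ j ∧ ∃ v : Fin n,
          C = {((Sum.inl (i, v) : UnaryVar c n), false), (Sum.inl (j, v), false)}) ∨
       (∃ i j : Fin ⌈c * Real.logb 2 n⌉₊, i ≠ j ∧ ∃ u v : Fin n, G.Adj u v ∧
          C = {((Sum.inr () : UnaryVar c n), true), (Sum.inl (i, u), false),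
               (Sum.inl (j, v), false)}) ∨
       (∃ i j : Fin ⌈c * Real.logb 2 n⌉₊, i ≠ j ∧ ∃ u v : Fin n, u ≠ v ∧ ¬ G.Adj u v ∧
          C = {((Sum.inr () : UnaryVar c n), false), (Sum.inl (i, u), false),
               (Sum.inl (j, v), false)})}

end

namespace CLB

/-- Roots close to one. -/
lemma exists_root (y : ℝ) (hy : 1 < y) (n : ℕ) : ∃ r : ℝ, 1 < r ∧ r ^ n ≤ y := by
  have hc : ContinuousAt (fun r : ℝ => r ^ n) 1 := by fun_prop
  have h1 : ∀ᶠ r in nhds (1 : ℝ), r ^ n < y := by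
    apply hc.eventually_lt continuousAt_const
    simpa using hy
  have h2 : ∀ᶠ r in nhdsWithin (1 : ℝ) (Set.Ioi 1), r ^ n < y ∧ 1 < r :=
    (h1.filter_mono nhdsWithin_le_nhds).and self_mem_nhdsWithin
  obtain ⟨r, hr, hr'⟩ := h2.exists
  exact ⟨r, hr', hr.le⟩

lemma pow_small (A : ℝ) (hA : 0 ≤ A) (r : ℝ) (hr : 1 < r) :
    ∃ ε : ℝ, 0 < ε ∧ ∀ k E : ℕ, (E : ℝ) ≤ ε * k → A ^ E ≤ r ^ k := by
  obtain ⟨s, hs⟩ := pow_unbounded_of_one_lt A hr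
  refine ⟨1 / (s + 1), by positivity, fun k E hE => ?_⟩
  have h1 : (s + 1) * E ≤ k := by
    have : ((s : ℝ) + 1) * E ≤ k := by
      have hp : (0 : ℝ) < s + 1 := by positivity
      calc ((s : ℝ) + 1) * E ≤ (s + 1) * (1 / (s + 1) * k) := by gcongr
        _ = k := by field_simp
    exact_mod_cast this
  calc A ^ E ≤ (r ^ (s + 1)) ^ E := by
        gcongr
        exact hs.le.trans (pow_le_pow_right₀ hr.le (by omega))
    _ = r ^ ((s + 1) * E) := by rw [pow_mul]
    _ ≤ r ^ k := pow_le_pow_right₀ hr.le h1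

/-- There are few small subsets. -/
lemma few_small (q : ℝ) (hq : 1 < q) : ∃ a : ℝ, 0 < a ∧ ∀ {β : Type} [DecidableEq β] (I : Finset β) (w : ℕ),
    (w : ℝ) ≤ a * I.card → ((I.powerset.filter (fun J => J.card ≤ w)).card : ℝ) ≤ q ^ I.card := by
  obtain ⟨r0, hr0, hr0q⟩ := exists_root q hq 2
  set r := min r0 2 with hrd
  have hr : 1 < r := by simp [hrd, hr0]
  have hr2 : r ≤ 2 := min_le_right _ _
  have hrq : r ^ 2 ≤ q := le_trans (by gcongr; exact min_le_left _ _) hr0q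
  obtain ⟨a, ha, h⟩ := pow_small (1 / (r - 1)) (by have : 0 < r - 1 := by linarith
                                                   positivity) r hr
  refine ⟨a, ha, fun {β} _ I w hw => ?_⟩
  have hx : 0 < r - 1 := by linarith
  have h1 : ∑ J ∈ I.powerset, (r - 1) ^ J.card = r ^ I.card := by
    have := Finset.sum_pow_mul_eq_add_pow (r - 1) 1 I
    simpa using this
  have h2 : ((I.powerset.filter (fun J => J.card ≤ w)).card : ℝ) * (r - 1) ^ w ≤ r ^ I.card := by
    rw [← h1, ← nsmul_eq_mul, ← Finset.sum_const]
    calc _ ≤ ∑ J ∈ I.powerset.filter (fun J => J.card ≤ w), (r - 1) ^ J.card := by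
          apply Finset.sum_le_sum
          intro J hJ
          exact pow_le_pow_of_le_one hx.le (by linarith) (Finset.mem_filter.1 hJ).2
      _ ≤ _ := Finset.sum_le_sum_of_subset_of_nonneg (Finset.filter_subset _ _)
          (fun _ _ _ => by positivity)
  have h3 := h I.card w hw
  calc ((I.powerset.filter (fun J => J.card ≤ w)).card : ℝ)
      = ((I.powerset.filter (fun J => J.card ≤ w)).card : ℝ) * (r - 1) ^ w * (1 / (r - 1)) ^ w := by
        rw [mul_assoc, ← mul_pow, mul_one_div_cancel hx.ne']; simp
    _ ≤ r ^ I.card * r ^ I.card := by gcongr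
    _ = (r ^ 2) ^ I.card := by rw [← mul_pow, sq]
    _ ≤ q ^ I.card := by gcongr

/-- Off-diagonal Ramsey. -/
lemma ramsey {V : Type} [DecidableEq V] (G : SimpleGraph V) (y z : ℝ) (hy : 1 ≤ y) (hz : 1 ≤ z)
    (hyz : 1 / y + 1 / z ≤ 1) (N : ℕ) : ∀ (s t : ℕ), s + t = N → ∀ (S : Finset V), 2 * y ^ s * z ^ t - 1 ≤ (S.card : ℝ) →
    (∃ I ⊆ S, I.card = s ∧ Gᶜ.IsClique (I : Set V)) ∨ (∃ I ⊆ S, I.card = t ∧ G.IsClique (I : Set V)) := by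
  induction N with
  | zero =>
    intro s t h S _
    left; exact ⟨∅, by simp, by simp; omega, by simp⟩
  | succ N ih =>
    intro s t h S hS
    rcases s with _ | s
    · left; exact ⟨∅, by simp, by simp, by simp⟩
    rcases t with _ | t
    · right; exact ⟨∅, by simp, by simp, by simp⟩
    have hy0 : 0 < y := by linarith
    have hz0 : 0 < z := by linarith
    have hpos : 0 < S.card := by
      have : 1 ≤ y ^ (s + 1) * z ^ (t + 1) := one_le_mul_of_one_le_of_one_le (one_le_pow₀ hy) (one_le_pow₀ hz)
      have : (0 : ℝ) < S.card := by nlinarith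
      exact_mod_cast this
    obtain ⟨v, hv⟩ := Finset.card_pos.1 hpos
    set A := (S.erase v).filter (fun u => G.Adj v u) with hA
    set B := (S.erase v).filter (fun u => ¬ G.Adj v u) with hB
    have hAB : A.card + B.card + 1 = S.card := by
      rw [hA, hB, Finset.card_filter_add_card_filter_not, Finset.card_erase_add_one hv]
    by_cases h1 : 2 * y ^ (s + 1) * z ^ t - 1 ≤ (A.card : ℝ)
    · rcases ih (s + 1) t (by omega) A h1 with ⟨I, hI, h2, h3⟩ | ⟨I, hI, h2, h3⟩
      · left; exact ⟨I, hI.trans ((Finset.filter_subset _ _).trans (Finset.erase_subset _ _)), h2, h3⟩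
      · right
        have hvI : v ∉ I := fun h => by have := hI h; simp [hA] at this
        refine ⟨insert v I, ?_, by rw [Finset.card_insert_of_notMem hvI, h2], ?_⟩
        · intro u hu
          rcases Finset.mem_insert.1 hu with rfl | hu
          · exact hv
          · exact Finset.mem_of_mem_erase (Finset.mem_filter.1 (hI hu)).1
        · rw [Finset.coe_insert, SimpleGraph.isClique_insert]
          exact ⟨h3, fun u hu _ => (Finset.mem_filter.1 (hI hu)).2⟩
    by_cases h1' : 2 * y ^ s * z ^ (t + 1) - 1 ≤ (B.card : ℝ)
    · rcases ih s (t + 1) (by omega) B h1' with ⟨I, hI, h2, h3⟩ | ⟨I, hI, h2, h3⟩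
      · left
        have hvI : v ∉ I := fun h => by have := hI h; simp [hB] at this
        refine ⟨insert v I, ?_, by rw [Finset.card_insert_of_notMem hvI, h2], ?_⟩
        · intro u hu
          rcases Finset.mem_insert.1 hu with rfl | hu
          · exact hv
          · exact Finset.mem_of_mem_erase (Finset.mem_filter.1 (hI hu)).1
        · rw [Finset.coe_insert, SimpleGraph.isClique_insert]
          refine ⟨h3, fun u hu huv => ?_⟩
          rw [SimpleGraph.compl_adj]
          exact ⟨huv, (Finset.mem_filter.1 (hI hu)).2⟩
      · right; exact ⟨I, hI.trans ((Finset.filter_subset _ _).trans (Finset.erase_subset _ _)), h2, h3⟩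
    exfalso
    push Not at h1 h1'
    have e : (A.card : ℝ) + B.card + 1 = S.card := by exact_mod_cast hAB
    have e1 : 2 * y ^ (s + 1) * z ^ t + 2 * y ^ s * z ^ (t + 1) ≤ 2 * y ^ (s + 1) * z ^ (t + 1) := by
      have : 2 * y ^ (s + 1) * z ^ t + 2 * y ^ s * z ^ (t + 1)
        = 2 * y ^ (s + 1) * z ^ (t + 1) * (1 / y + 1 / z) := by
        field_simp
        ring
      rw [this]
      exact mul_le_of_le_one_right (by positivity) hyz
    linarith

end CLB


namespace CLB

lemma markov {V : Type} (A : Finset V) (f : V → ℝ) (hf : ∀ a, 0 ≤ f a) (t : ℝ) (ht : 0 ≤ t)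
    (h : ∑ a ∈ A, f a ≤ t * A.card) : (A.card : ℝ) / 2 ≤ (A.filter (fun a => f a ≤ 2 * t)).card := by
  by_contra hcon
  push Not at hcon
  have h1 : (A.filter (fun a => f a ≤ 2 * t)).card + (A.filter (fun a => ¬ f a ≤ 2 * t)).card = A.card :=
    Finset.card_filter_add_card_filter_not _
  have h1' : ((A.filter (fun a => f a ≤ 2 * t)).card : ℝ) + (A.filter (fun a => ¬ f a ≤ 2 * t)).card = A.card := by
    exact_mod_cast h1
  have hb : (A.card : ℝ) / 2 < (A.filter (fun a => ¬ f a ≤ 2 * t)).card := by linarith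
  have hne : (A.filter (fun a => ¬ f a ≤ 2 * t)).Nonempty := by
    rw [← Finset.card_pos]
    have : (0 : ℝ) < (A.filter (fun a => ¬ f a ≤ 2 * t)).card := lt_of_le_of_lt (by positivity) hb
    exact_mod_cast this
  have h2 : ∑ a ∈ A.filter (fun a => ¬ f a ≤ 2 * t), 2 * t < ∑ a ∈ A.filter (fun a => ¬ f a ≤ 2 * t), f a := by
    apply Finset.sum_lt_sum_of_nonempty hne
    intro a ha
    exact not_le.1 (Finset.mem_filter.1 ha).2
  have h3 : ∑ a ∈ A.filter (fun a => ¬ f a ≤ 2 * t), f a ≤ ∑ a ∈ A, f a :=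
    Finset.sum_le_sum_of_subset_of_nonneg (Finset.filter_subset _ _) (fun _ _ _ => hf _)
  rw [Finset.sum_const, nsmul_eq_mul] at h2
  nlinarith

lemma eventually_lin (C : ℝ) (q : ℝ) (hq : 1 < q) : ∃ K : ℕ, ∀ k : ℕ, K ≤ k → C * (k + 1) ≤ q ^ k := by
  have h := tendsto_pow_const_div_const_pow_of_one_lt 1 hq
  have h0 := tendsto_pow_const_div_const_pow_of_one_lt 0 hq
  have h2 := ((h.add h0).const_mul C)
  simp only [add_zero, mul_zero] at h2
  have h3 := h2.eventually (gt_mem_nhds (show (0 : ℝ) < 1 by norm_num))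
  obtain ⟨K, hK⟩ := Filter.eventually_atTop.1 h3
  refine ⟨K, fun k hk => ?_⟩
  have := hK k hk
  have hp : (0 : ℝ) < q ^ k := by positivity
  rw [pow_one, pow_zero, ← add_div, ← mul_div_assoc, div_lt_one hp] at this
  exact this.le

/-- One amplification step in the proof of the density lemma. -/
lemma amplify {V : Type} [DecidableEq V] (G : SimpleGraph V) (δ a q n0 x : ℝ) (M : ℕ) (hδ : 0 ≤ δ) (hδ8 : 4 * δ ≤ 1 / 2)
    (ha : 4 * δ ≤ a) (hq : 1 < q) (hx : 0 ≤ x)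
    (hsmall : ∀ (I : Finset V) (w : ℕ),
      (w : ℝ) ≤ a * I.card → ((I.powerset.filter (fun J => J.card ≤ w)).card : ℝ) ≤ q ^ I.card)
    (hM : ∀ I : Finset V, Gᶜ.IsClique (I : Set V) → I.card ≤ M)
    (hind : ∀ S : Finset V, n0 ≤ S.card → ∃ I ⊆ S, Gᶜ.IsClique (I : Set V) ∧ x ≤ I.card)
    (A B : Finset V) (hAB : ∑ a ∈ A, ((B.filter (fun b => G.Adj a b)).card : ℝ) ≤ δ * A.card * B.card)
    (hA : 2 * n0 ≤ A.card) (hB : 4 * q ^ M * n0 ≤ B.card) (hBM : 4 * (M : ℝ) ≤ B.card) :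
    ∃ I ⊆ A ∪ B, Gᶜ.IsClique (I : Set V) ∧ 3 / 2 * x ≤ I.card := by
  have hA' := markov A (fun a => ((B.filter (fun b => G.Adj a b)).card : ℝ)) (fun _ => by positivity)
    (δ * B.card) (by positivity) (by rw [mul_right_comm]; exact hAB)
  set A' := A.filter (fun a => ((B.filter (fun b => G.Adj a b)).card : ℝ) ≤ 2 * (δ * B.card)) with hA'd
  obtain ⟨I, hIA', hI, hIx⟩ := hind A' (by linarith)
  have hIM := hM I hI
  have hsum : ∑ b ∈ B, ((I.filter (fun a => G.Adj a b)).card : ℝ) ≤ (2 * δ * I.card) * B.card := by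
    have : ∑ b ∈ B, ((I.filter (fun a => G.Adj a b)).card : ℝ) = ∑ a ∈ I, ((B.filter (fun b => G.Adj a b)).card : ℝ) := by
      simp only [Finset.card_filter, Nat.cast_sum]
      rw [Finset.sum_comm]
    rw [this]
    calc _ ≤ ∑ a ∈ I, 2 * (δ * B.card) := Finset.sum_le_sum (fun i hi => (Finset.mem_filter.1 (hIA' hi)).2)
      _ = _ := by rw [Finset.sum_const, nsmul_eq_mul]; ring
  have hB1 := markov B (fun b => ((I.filter (fun a => G.Adj a b)).card : ℝ)) (fun _ => by positivity)
    (2 * δ * I.card) (by positivity) hsum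
  set B1 := B.filter (fun b => ((I.filter (fun a => G.Adj a b)).card : ℝ) ≤ 2 * (2 * δ * I.card)) with hB1d
  set B2 := B1 \ I with hB2d
  have hB2 : (B.card : ℝ) / 4 ≤ B2.card := by
    have h1 : B1.card ≤ B2.card + I.card := by
      have : B1.card - I.card ≤ B2.card := Finset.le_card_sdiff I B1
      omega
    have h1' : (B1.card : ℝ) ≤ B2.card + I.card := by exact_mod_cast h1
    have h2 : (I.card : ℝ) ≤ M := by exact_mod_cast hIM
    linarith
  set w := ⌊4 * δ * I.card⌋₊ with hw
  have hwle : (w : ℝ) ≤ 4 * δ * I.card := Nat.floor_le (by positivity)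
  set P := I.powerset.filter (fun J => J.card ≤ w) with hP
  have hPc : (P.card : ℝ) ≤ q ^ M := by
    refine (hsmall I w (hwle.trans ?_)).trans (pow_le_pow_right₀ hq.le hIM)
    gcongr
  have hmaps : ∀ b ∈ B2, I.filter (fun a => G.Adj a b) ∈ P := by
    intro b hb
    rw [hP, Finset.mem_filter, Finset.mem_powerset]
    refine ⟨Finset.filter_subset _ _, ?_⟩
    apply Nat.le_floor
    have := (Finset.mem_filter.1 (Finset.mem_sdiff.1 hb).1).2
    linarith
  have hPne : P.Nonempty := ⟨∅, by simp [hP]⟩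
  have hPpos : (0 : ℝ) < P.card := by exact_mod_cast Finset.card_pos.2 hPne
  obtain ⟨J, hJ, hJc⟩ : ∃ J ∈ P, n0 ≤ ((B2.filter (fun b => I.filter (fun a => G.Adj a b) = J)).card : ℝ) := by
    by_contra hcon
    push Not at hcon
    have h1 : B2.card = ∑ J ∈ P, (B2.filter (fun b => I.filter (fun a => G.Adj a b) = J)).card :=
      Finset.card_eq_sum_card_fiberwise hmaps
    have h2 : (B2.card : ℝ) < P.card * n0 := by
      rw [h1, Nat.cast_sum, ← nsmul_eq_mul, ← Finset.sum_const]
      exact Finset.sum_lt_sum_of_nonempty hPne hcon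
    have hn0 : 0 < n0 := by
      by_contra hn
      push Not at hn
      have : (P.card : ℝ) * n0 ≤ 0 := mul_nonpos_of_nonneg_of_nonpos hPpos.le hn
      have : (0 : ℝ) ≤ B2.card := by positivity
      linarith
    nlinarith
  obtain ⟨I', hI'B, hI', hI'x⟩ := hind _ hJc
  have hJ2 := Finset.mem_filter.1 hJ
  have hJI := Finset.mem_powerset.1 hJ2.1
  have hdisj : Disjoint (I \ J) I' := by
    rw [Finset.disjoint_left]
    intro v hv hv'
    have := (Finset.mem_filter.1 (hI'B hv')).1
    exact (Finset.mem_sdiff.1 this).2 (Finset.mem_sdiff.1 hv).1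
  refine ⟨(I \ J) ∪ I', ?_, ?_, ?_⟩
  · apply Finset.union_subset_union
    · exact Finset.sdiff_subset.trans (hIA'.trans (Finset.filter_subset _ _))
    · exact hI'B.trans ((Finset.filter_subset _ _).trans (Finset.sdiff_subset.trans (Finset.filter_subset _ _)))
  · have key : ∀ u ∈ I \ J, ∀ v ∈ I', ¬ G.Adj u v := by
      intro u hu v hv hadj
      have h1 := (Finset.mem_filter.1 (hI'B hv)).2
      have h2 := Finset.mem_sdiff.1 hu
      apply h2.2
      rw [← h1, Finset.mem_filter]
      exact ⟨h2.1, hadj⟩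
    intro u hu v hv huv
    rw [Finset.mem_coe, Finset.mem_union] at hu hv
    rcases hu with hu | hu <;> rcases hv with hv | hv
    · exact hI (Finset.mem_sdiff.1 hu).1 (Finset.mem_sdiff.1 hv).1 huv
    · rw [SimpleGraph.compl_adj]; exact ⟨huv, key u hu v hv⟩
    · rw [SimpleGraph.compl_adj]; exact ⟨huv, fun h => key v hv u hu h.symm⟩
    · exact hI' hu hv huv
  · rw [Finset.card_union_of_disjoint hdisj, Finset.card_sdiff_of_subset hJI, Nat.cast_add,
      Nat.cast_sub (Finset.card_le_card hJI)]
    have : (J.card : ℝ) ≤ w := by exact_mod_cast hJ2.2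
    nlinarith

/-- A Ramsey graph has a large subset all of whose large pairs have positive density. -/
lemma density_lemma (C : ℕ) : ∃ b δ : ℝ, 1 < b ∧ 0 < δ ∧ δ ≤ 1 ∧ ∃ K : ℕ, ∀ k : ℕ, K ≤ k →
    ∀ (G : SimpleGraph (Fin (2 ^ k))) (m : ℕ), m ≤ C * k →
    (∀ T : Finset (Fin (2 ^ k)), T.card = m → ¬ G.IsClique (T : Set (Fin (2 ^ k)))) →
    (∀ T : Finset (Fin (2 ^ k)), T.card = m → ¬ Gᶜ.IsClique (T : Set (Fin (2 ^ k)))) →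
    ∃ S : Finset (Fin (2 ^ k)), (3 / 2 : ℝ) ^ k ≤ S.card ∧ ∀ A B : Finset (Fin (2 ^ k)), A ⊆ S → B ⊆ S →
      (S.card : ℝ) / b ^ k ≤ A.card → (S.card : ℝ) / b ^ k ≤ B.card →
      δ * A.card * B.card ≤ ∑ a ∈ A, ((B.filter (fun b => G.Adj a b)).card : ℝ) := by
  -- Ramsey constants
  obtain ⟨z, hz, hzC⟩ := exists_root (5 / 4) (by norm_num) (C + 1)
  have hz0 : 0 < z - 1 := by linarith
  have hy1 : 1 ≤ z / (z - 1) := by rw [le_div_iff₀ hz0]; linarith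
  obtain ⟨a, ha, hy⟩ := pow_small (z / (z - 1)) (by linarith) (11 / 10) (by norm_num)
  obtain ⟨t, ht⟩ := pow_unbounded_of_one_lt ((C + 1) / (a / 2)) (show (1 : ℝ) < 3 / 2 by norm_num)
  rw [div_lt_iff₀ (by positivity)] at ht
  obtain ⟨q, hq, hqt⟩ := exists_root (4 / 3) (by norm_num) ((C + 2) * t)
  obtain ⟨a', ha', hsmall⟩ := few_small q hq
  set δ := min (1 / 8) (a' / 4) with hδd
  have hδ : 0 < δ := by positivity
  have hδ8 : δ ≤ 1 / 8 := min_le_left _ _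
  have hδa : 4 * δ ≤ a' := by have : δ ≤ a' / 4 := min_le_right _ _
                              linarith
  obtain ⟨K1, hK1⟩ := eventually_lin 4 q hq
  obtain ⟨K2, hK2⟩ := eventually_lin (4 * (C + 1)) (3 / 2) (by norm_num)
  obtain ⟨K3, hK3⟩ := eventually_lin 2 (12 / 11) (by norm_num)
  obtain ⟨K4, hK4⟩ := exists_nat_gt (2 / a)
  refine ⟨q, δ, hq, hδ, by linarith, max (max K1 K2) (max K3 (max K4 1)), fun k hk G m hm hcl hin => ?_⟩
  simp only [max_le_iff] at hk
  obtain ⟨⟨hk1, hk2⟩, hk3, hk4, hk0⟩ := hk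
  have hq1 := hK1 k hk1
  have hq2 := hK2 k hk2
  have hq3 := hK3 k hk3
  have hkpos : (1 : ℝ) ≤ k := by exact_mod_cast hk0
  have hq0 : 0 < q := by linarith
  by_contra hcon
  push Not at hcon
  have hM : ∀ I : Finset (Fin (2 ^ k)), Gᶜ.IsClique (I : Set (Fin (2 ^ k))) → I.card ≤ C * k := by
    intro I hI
    by_contra h
    push Not at h
    obtain ⟨J, hJI, hJ⟩ := Finset.exists_subset_card_eq (show m ≤ I.card by omega)
    exact hin J hJ (hI.subset (by exact_mod_cast hJI))
  have claim : ∀ j : ℕ, ∀ S : Finset (Fin (2 ^ k)), (3 / 2 : ℝ) ^ k * (q ^ ((C + 2) * k)) ^ j ≤ S.card →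
      ∃ I ⊆ S, Gᶜ.IsClique (I : Set (Fin (2 ^ k))) ∧ (3 / 2 : ℝ) ^ j * (a / 2 * k) ≤ I.card := by
    intro j
    induction j with
    | zero =>
      intro S hS
      set s := ⌊a * k⌋₊ with hs
      have hsle : (s : ℝ) ≤ a * k := Nat.floor_le (by positivity)
      have hak : 2 ≤ a * k := by
        have h1 : 2 / a < k := hK4.trans_le (by exact_mod_cast hk4)
        rw [div_lt_iff₀ ha] at h1
        linarith
      have hsge : a / 2 * k ≤ s := by
        have := Nat.lt_floor_add_one (a * k)
        rw [← hs] at this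
        linarith
      have hR := ramsey G (z / (z - 1)) z hy1 hz.le (by field_simp; linarith) (s + m) s m rfl S (by
        have e1 := hy k s hsle
        have e2 : z ^ m ≤ (5 / 4) ^ k := by
          calc z ^ m ≤ z ^ ((C + 1) * k) := pow_le_pow_right₀ hz.le (by nlinarith)
            _ = (z ^ (C + 1)) ^ k := by rw [pow_mul]
            _ ≤ _ := by gcongr
        have e3 : (2 : ℝ) ≤ (12 / 11) ^ k := by linarith
        calc 2 * (z / (z - 1)) ^ s * z ^ m - 1 ≤ 2 * (z / (z - 1)) ^ s * z ^ m := by linarith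
          _ ≤ (12 / 11) ^ k * (11 / 10) ^ k * (5 / 4) ^ k := by gcongr
          _ = (3 / 2) ^ k := by rw [← mul_pow, ← mul_pow]; norm_num
          _ ≤ S.card := by simpa using hS)
      rcases hR with ⟨I, hIS, hIc, hI⟩ | ⟨I, hIS, hIc, hI⟩
      · refine ⟨I, hIS, hI, ?_⟩
        rw [hIc]; simpa using hsge
      · exact absurd hI (hcl I hIc)
    | succ j ih =>
      intro S hS
      have hl1 : 1 ≤ q ^ ((C + 2) * k) := one_le_pow₀ hq.le
      have hn : (3 / 2 : ℝ) ^ k ≤ (3 / 2 : ℝ) ^ k * (q ^ ((C + 2) * k)) ^ j :=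
        le_mul_of_one_le_right (by positivity) (one_le_pow₀ hl1)
      have hsplit : q ^ ((C + 2) * k) = q ^ (C * k) * q ^ k * q ^ k := by
        rw [← pow_add, ← pow_add]; congr 1; ring
      have hqC : 1 ≤ q ^ (C * k) := one_le_pow₀ hq.le
      have hqk : 1 ≤ q ^ k := one_le_pow₀ hq.le
      have hq4 : 4 ≤ q ^ k := by linarith
      set n0 := (3 / 2 : ℝ) ^ k * (q ^ ((C + 2) * k)) ^ j with hn0
      have hn0pos : 0 < n0 := by positivity
      have hS' : n0 * (q ^ (C * k) * q ^ k * q ^ k) ≤ S.card := by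
        rw [← hsplit]; rw [pow_succ, ← mul_assoc] at hS; exact hS
      obtain ⟨A, B, hA, hB, hAc, hBc, hAB⟩ := hcon S (by
        refine hn.trans (le_trans ?_ hS')
        refine le_mul_of_one_le_right hn0pos.le ?_
        rw [← hsplit]; exact hl1)
      have hd : 4 * q ^ (C * k) * n0 ≤ S.card / q ^ k := by
        rw [le_div_iff₀ (by positivity)]
        refine le_trans ?_ hS'
        have : 4 * q ^ (C * k) * n0 * q ^ k = n0 * (q ^ (C * k) * 4 * q ^ k) := by ring
        rw [this]
        gcongr
      have hd4 : 4 * n0 ≤ 4 * q ^ (C * k) * n0 := by nlinarith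
      obtain ⟨I, hI, hI2, hI3⟩ := amplify G δ a' q n0 ((3 / 2 : ℝ) ^ j * (a / 2 * k)) (C * k) hδ.le (by linarith) hδa hq
        (by positivity) (fun I w h => hsmall I w h) hM ih A B hAB.le (by linarith) (by linarith) (by
          push_cast
          nlinarith)
      refine ⟨I, hI.trans (Finset.union_subset hA hB), hI2, ?_⟩
      rw [pow_succ]
      linarith
  obtain ⟨I, -, hI, hIc⟩ := claim t Finset.univ (by
    rw [Finset.card_univ, Fintype.card_fin]
    push_cast
    have : (q ^ ((C + 2) * k)) ^ t = (q ^ ((C + 2) * t)) ^ k := by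
      rw [← pow_mul, ← pow_mul]; congr 1; ring
    rw [this]
    calc _ ≤ (3 / 2 : ℝ) ^ k * (4 / 3) ^ k := by gcongr
      _ = 2 ^ k := by rw [← mul_pow]; norm_num)
  have h1 : (I.card : ℝ) ≤ C * k := by exact_mod_cast hM I hI
  nlinarith

end CLB


namespace CLB

/-- The popular literal. -/
lemma popular {ι β : Type} [Fintype ι] [Fintype β] [DecidableEq ι] [DecidableEq β]
    (FA : Finset (Finset ((ι × β) × Bool))) (hFA : FA.Nonempty) (Fx : Finset (ι × β)) (e : ι → ℕ)
    (κ : ℝ) (E F H : ℕ) (hβ : 0 < Fintype.card β) (hH : 4 * Fintype.card β * F ≤ H) (hF : 0 < F)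
    (hκ0 : 0 < κ) (hκ : κ * Fintype.card ι ≤ F)
    (hfat : ∀ C ∈ FA, H ≤ (C.filter (fun l => l.1 ∉ Fx)).card) (he : ∑ i, e i < E * F) :
    ∃ l : (ι × β) × Bool, l.1 ∉ Fx ∧ e l.1.1 < E ∧
      κ * FA.card ≤ (FA.filter (fun C => l ∈ C)).card := by
  set Full := Finset.univ.filter (fun i => E ≤ e i) with hFull
  have hFc : Full.card ≤ F := by
    have h1 : Full.card * E ≤ ∑ i, e i := by
      calc Full.card * E = ∑ i ∈ Full, E := by simp
        _ ≤ ∑ i ∈ Full, e i := Finset.sum_le_sum (fun i hi => (Finset.mem_filter.1 hi).2)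
        _ ≤ _ := Finset.sum_le_sum_of_subset (Finset.subset_univ _)
    by_contra h
    push Not at h
    have : E * F ≤ Full.card * E := by rw [mul_comm]; gcongr
    omega
  set Us := (Finset.univ : Finset ((ι × β) × Bool)).filter (fun l => l.1 ∉ Fx ∧ e l.1.1 < E) with hUs
  have husable : ∀ C ∈ FA, 2 * Fintype.card β * F ≤ (Us.filter (fun l => l ∈ C)).card := by
    intro C hC
    have h1 := hfat C hC
    have h2 : C.filter (fun l => l.1 ∉ Fx) ⊆ (Us.filter (fun l => l ∈ C)) ∪ ((Full ×ˢ Finset.univ) ×ˢ Finset.univ) := by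
      intro l hl
      have hl' := Finset.mem_filter.1 hl
      by_cases h : e l.1.1 < E
      · apply Finset.mem_union_left
        simp only [hUs, Finset.mem_filter, Finset.mem_univ, true_and]
        exact ⟨⟨hl'.2, h⟩, hl'.1⟩
      · apply Finset.mem_union_right
        simp only [hFull, Finset.mem_product, Finset.mem_filter, Finset.mem_univ, true_and, and_true]
        omega
    have h3 := (Finset.card_le_card h2).trans (Finset.card_union_le _ _)
    simp only [Finset.card_product, Finset.card_univ, Fintype.card_bool] at h3
    have h4 : Full.card * Fintype.card β * 2 ≤ F * Fintype.card β * 2 := by gcongr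
    nlinarith
  have hdc : ∑ l ∈ Us, (FA.filter (fun C => l ∈ C)).card = ∑ C ∈ FA, (Us.filter (fun l => l ∈ C)).card := by
    simp only [Finset.card_filter]
    rw [Finset.sum_comm]
  have hge : FA.card * (2 * Fintype.card β * F) ≤ ∑ l ∈ Us, (FA.filter (fun C => l ∈ C)).card := by
    rw [hdc, ← smul_eq_mul, ← Finset.sum_const]
    exact Finset.sum_le_sum husable
  have hpos : 0 < FA.card * (2 * Fintype.card β * F) := by
    have := Finset.card_pos.2 hFA
    positivity
  have hUne : Us.Nonempty := by
    by_contra h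
    rw [Finset.not_nonempty_iff_eq_empty] at h
    rw [h, Finset.sum_empty] at hge
    omega
  by_contra hcon
  push Not at hcon
  have hlt : ∑ l ∈ Us, ((FA.filter (fun C => l ∈ C)).card : ℝ) < ∑ l ∈ Us, κ * FA.card := by
    apply Finset.sum_lt_sum_of_nonempty hUne
    intro l hl
    have hl' := (Finset.mem_filter.1 hl).2
    exact hcon l hl'.1 hl'.2
  rw [Finset.sum_const, nsmul_eq_mul] at hlt
  have hUc : (Us.card : ℝ) ≤ Fintype.card ι * Fintype.card β * 2 := by
    have : Us.card ≤ Fintype.card ι * Fintype.card β * 2 := by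
      refine (Finset.card_le_univ _).trans ?_
      simp
    exact_mod_cast this
  have hge' : (FA.card : ℝ) * (2 * Fintype.card β * F) ≤ ∑ l ∈ Us, ((FA.filter (fun C => l ∈ C)).card : ℝ) := by
    exact_mod_cast hge
  have h5 : (Us.card : ℝ) * (κ * FA.card) ≤ FA.card * (2 * Fintype.card β * F) := by
    calc (Us.card : ℝ) * (κ * FA.card) ≤ (Fintype.card ι * Fintype.card β * 2) * (κ * FA.card) := by gcongr
      _ = FA.card * (2 * Fintype.card β * (κ * Fintype.card ι)) := by ring
      _ ≤ _ := by gcongr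
  linarith

/-- Alive: no literal of the clause is forced true. -/
def Alive {ι β V : Type} (bit : V → β → Bool) (Sx : ι → Finset V) (C : Finset ((ι × β) × Bool)) : Prop :=
  ∀ l ∈ C, ∃ v ∈ Sx l.1.1, bit v l.1.2 ≠ l.2

lemma greedy_aux {ι β V : Type} [Fintype ι] [Fintype β] [DecidableEq ι] [DecidableEq β] [DecidableEq V]
    (bit : V → β → Bool) (S : Finset V) (Pi : Finset (Finset ((ι × β) × Bool)))
    (α κ : ℝ) (hα0 : 0 < α) (hα1 : α < 1) (hκ0 : 0 < κ) (hκ1 : κ < 1) (E F H : ℕ)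
    (hβ : 0 < Fintype.card β) (hH : 4 * Fintype.card β * F ≤ H) (hF : 0 < F)
    (hκ : κ * Fintype.card ι ≤ F) (hL : Pi.card * (1 - κ) ^ (E * F) < 1) (n : ℕ) :
    ∀ (Sx : ι → Finset V) (Fx : Finset (ι × β)) (e : ι → ℕ), Fxᶜ.card ≤ n →
      (∀ i, Sx i ⊆ S) →
      (∀ p ∈ Fx, ∀ u ∈ Sx p.1, ∀ v ∈ Sx p.1, bit u p.2 = bit v p.2) →
      (∀ i, e i ≤ E) →
      (∀ i, α ^ (e i) * (1 - α) ^ (Fx.filter (fun p => p.1 = i)).card * S.card ≤ (Sx i).card) →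
      ((Pi.filter (fun C => Alive bit Sx C ∧ H ≤ (C.filter (fun l => l.1 ∉ Fx)).card)).card : ℝ) ≤
        Pi.card * (1 - κ) ^ (∑ i, e i) →
    ∃ (Sx : ι → Finset V) (Fx : Finset (ι × β)), (∀ i, Sx i ⊆ S) ∧
      (∀ p ∈ Fx, ∀ u ∈ Sx p.1, ∀ v ∈ Sx p.1, bit u p.2 = bit v p.2) ∧
      (∀ i, α ^ E * (1 - α) ^ (Fintype.card β) * S.card ≤ (Sx i).card) ∧
      ∀ C ∈ Pi, Alive bit Sx C → (C.filter (fun l => l.1 ∉ Fx)).card < H := by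
  induction n with
  | zero => ?_
  | succ n ih => ?_
  all_goals
    intro Sx Fx e hn hS hFx he hsize hcount
    set FA := Pi.filter (fun C => Alive bit Sx C ∧ H ≤ (C.filter (fun l => l.1 ∉ Fx)).card) with hFA
    by_cases hne : FA.Nonempty
    swap
    · refine ⟨Sx, Fx, hS, hFx, fun i => le_trans ?_ (hsize i), fun C hC hal => ?_⟩
      · have h1 : (Fx.filter (fun p => p.1 = i)).card ≤ Fintype.card β := by
          rw [← Finset.card_univ]
          refine Finset.card_le_card_of_injOn Prod.snd (fun _ _ => by simp) ?_
          intro p hp p' hp' h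
          have h1 := (Finset.mem_filter.1 hp).2
          have h2 := (Finset.mem_filter.1 hp').2
          exact Prod.ext (h1.trans h2.symm) h
        have h2 : α ^ E ≤ α ^ (e i) := pow_le_pow_of_le_one hα0.le hα1.le (he i)
        have h3 : (1 - α) ^ (Fintype.card β) ≤ (1 - α) ^ (Fx.filter (fun p => p.1 = i)).card :=
          pow_le_pow_of_le_one (by linarith) (by linarith) h1
        have h4 : 0 < 1 - α := by linarith
        gcongr
      · by_contra h
        push Not at h
        exact hne ⟨C, by rw [hFA, Finset.mem_filter]; exact ⟨hC, hal, h⟩⟩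
    have hsum : ∑ i, e i < E * F := by
      by_contra h
      push Not at h
      have h1 : (1 : ℝ) ≤ FA.card := by exact_mod_cast Finset.card_pos.2 hne
      have h2 : (1 - κ) ^ (∑ i, e i) ≤ (1 - κ) ^ (E * F) := pow_le_pow_of_le_one (by linarith) (by linarith) h
      have h3 : (Pi.card : ℝ) * (1 - κ) ^ (∑ i, e i) ≤ Pi.card * (1 - κ) ^ (E * F) := by gcongr
      linarith
    obtain ⟨l, hl, hlE, hlc⟩ := popular FA hne Fx e κ E F H hβ hH hF hκ0 hκ
      (fun C hC => (Finset.mem_filter.1 hC).2.2) hsum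
  · have : l.1 ∈ Fxᶜ := Finset.mem_compl.2 hl
    have := Finset.card_pos.2 ⟨_, this⟩
    omega
  · obtain ⟨⟨i, b⟩, a⟩ := l
    simp only at hl hlE
    have hFxc : (insert (i, b) Fx)ᶜ.card ≤ n := by
      have h1 : (insert (i, b) Fx)ᶜ = Fxᶜ.erase (i, b) := by rw [Finset.compl_insert]
      rw [h1, Finset.card_erase_of_mem (Finset.mem_compl.2 hl)]
      omega
    have hfc : ∀ j, ((insert (i, b) Fx).filter (fun p => p.1 = j)).card =
        (Fx.filter (fun p => p.1 = j)).card + if j = i then 1 else 0 := by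
      intro j
      rw [Finset.filter_insert]
      by_cases h : j = i
      · rw [if_pos h.symm, if_pos h, Finset.card_insert_of_notMem]
        exact fun h' => hl (Finset.mem_filter.1 h').1
      · rw [if_neg (fun h' => h h'.symm), if_neg h]; simp
    -- common part: restricting `i` to value `a'` at `b`
    have hrestr : ∀ a' : Bool, ∀ Sx', Sx' = Function.update Sx i ((Sx i).filter (fun v => bit v b = a')) →
        (∀ j, Sx' j ⊆ Sx j) ∧
        (∀ p ∈ insert (i, b) Fx, ∀ u ∈ Sx' p.1, ∀ v ∈ Sx' p.1, bit u p.2 = bit v p.2) := by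
      rintro a' Sx' rfl
      have hsub : ∀ j, Function.update Sx i ((Sx i).filter (fun v => bit v b = a')) j ⊆ Sx j := by
        intro j
        by_cases h : j = i
        · subst h; simp
        · simp [Function.update_of_ne h]
      refine ⟨hsub, ?_⟩
      intro p hp u hu v hv
      rcases Finset.mem_insert.1 hp with rfl | hp
      · simp only [Function.update_self, Finset.mem_filter] at hu hv
        rw [hu.2, hv.2]
      · exact hFx p hp u (hsub _ hu) v (hsub _ hv)
    have hFAsub : ∀ Sx' : ι → Finset V, (∀ j, Sx' j ⊆ Sx j) →
        Pi.filter (fun C => Alive bit Sx' C ∧ H ≤ (C.filter (fun l => l.1 ∉ insert (i, b) Fx)).card) ⊆ FA := by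
      intro Sx' hsub C hC
      rw [Finset.mem_filter] at hC
      rw [hFA, Finset.mem_filter]
      refine ⟨hC.1, fun l hl => ?_, hC.2.2.trans (Finset.card_le_card ?_)⟩
      · obtain ⟨v, hv, hv'⟩ := hC.2.1 l hl
        exact ⟨v, hsub _ hv, hv'⟩
      · intro l hl
        rw [Finset.mem_filter] at hl ⊢
        exact ⟨hl.1, fun h => hl.2 (Finset.mem_insert_of_mem h)⟩
    by_cases hcase : α * (Sx i).card ≤ ((Sx i).filter (fun v => bit v b = a)).card
    · set Sx' := Function.update Sx i ((Sx i).filter (fun v => bit v b = a)) with hSx'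
      obtain ⟨h1, h2⟩ := hrestr a Sx' hSx'
      refine ih Sx' (insert (i, b) Fx) (Function.update e i (e i + 1)) hFxc (fun j => (h1 j).trans (hS j)) h2 ?_ ?_ ?_
      · intro j
        by_cases h : j = i
        · subst h; simp; omega
        · simp [Function.update_of_ne h, he j]
      · intro j
        rw [hfc]
        by_cases h : j = i
        · subst h
          simp only [Function.update_self, if_true, hSx']
          refine le_trans ?_ hcase
          have h3 := hsize j
          have h4 : 0 < 1 - α := by linarith
          calc _ = α * (α ^ e j * (1 - α) ^ (Fx.filter (fun p => p.1 = j)).card * S.card) * (1 - α) := by ring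
            _ ≤ α * (α ^ e j * (1 - α) ^ (Fx.filter (fun p => p.1 = j)).card * S.card) * 1 := by
                gcongr; linarith
            _ ≤ _ := by rw [mul_one]; gcongr
        · simp only [hSx', Function.update_of_ne h, if_neg h, add_zero]
          exact hsize j
      · have hsum' : ∑ j, Function.update e i (e i + 1) j = ∑ j, e j + 1 := by
          rw [Finset.sum_update_of_mem (Finset.mem_univ i),
            ← Finset.add_sum_erase Finset.univ e (Finset.mem_univ i), Finset.sdiff_singleton_eq_erase]
          ring
        rw [hsum']
        have h3 : Pi.filter (fun C => Alive bit Sx' C ∧ H ≤ (C.filter (fun l => l.1 ∉ insert (i, b) Fx)).card)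
            ⊆ FA.filter (fun C => ¬ ((i, b), a) ∈ C) := by
          intro C hC
          rw [Finset.mem_filter]
          refine ⟨hFAsub Sx' h1 hC, fun hmem => ?_⟩
          obtain ⟨v, hv, hv'⟩ := (Finset.mem_filter.1 hC).2.1 _ hmem
          simp only [hSx', Function.update_self, Finset.mem_filter] at hv
          exact hv' hv.2
        have h4 : (FA.filter (fun C => ((i, b), a) ∈ C)).card + (FA.filter (fun C => ¬ ((i, b), a) ∈ C)).card = FA.card :=
          Finset.card_filter_add_card_filter_not _
        have h4' : ((FA.filter (fun C => ((i, b), a) ∈ C)).card : ℝ) + (FA.filter (fun C => ¬ ((i, b), a) ∈ C)).card = FA.card := by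
          exact_mod_cast h4
        have h5 : ((Pi.filter (fun C => Alive bit Sx' C ∧ H ≤ (C.filter (fun l => l.1 ∉ insert (i, b) Fx)).card)).card : ℝ)
            ≤ (FA.filter (fun C => ¬ ((i, b), a) ∈ C)).card := by exact_mod_cast Finset.card_le_card h3
        have h6 : 0 < 1 - κ := by linarith
        calc _ ≤ (1 - κ) * FA.card := by linarith
          _ ≤ (1 - κ) * (Pi.card * (1 - κ) ^ (∑ i, e i)) := by gcongr
          _ = _ := by ring
    · set Sx' := Function.update Sx i ((Sx i).filter (fun v => bit v b = !a)) with hSx'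
      obtain ⟨h1, h2⟩ := hrestr (!a) Sx' hSx'
      refine ih Sx' (insert (i, b) Fx) e hFxc (fun j => (h1 j).trans (hS j)) h2 he ?_ ?_
      · intro j
        rw [hfc]
        by_cases h : j = i
        · subst h
          simp only [Function.update_self, if_true, hSx']
          have h3 := hsize j
          have h4 : 0 < 1 - α := by linarith
          have h5 : ((Sx j).filter (fun v => bit v b = a)).card + ((Sx j).filter (fun v => ¬ bit v b = a)).card = (Sx j).card :=
            Finset.card_filter_add_card_filter_not _
          have h5' : (((Sx j).filter (fun v => bit v b = a)).card : ℝ) + ((Sx j).filter (fun v => ¬ bit v b = a)).card = (Sx j).card := by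
            exact_mod_cast h5
          have h6 : (Sx j).filter (fun v => bit v b = !a) = (Sx j).filter (fun v => ¬ bit v b = a) := by
            apply Finset.filter_congr
            intro v _
            simp [Bool.eq_not]
          rw [h6]
          calc _ = (1 - α) * (α ^ e j * (1 - α) ^ (Fx.filter (fun p => p.1 = j)).card * S.card) := by ring
            _ ≤ (1 - α) * (Sx j).card := by gcongr
            _ ≤ _ := by linarith
        · simp only [hSx', Function.update_of_ne h, if_neg h, add_zero]
          exact hsize j
      · refine le_trans ?_ hcount
        exact_mod_cast Finset.card_le_card (hFAsub Sx' h1)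

lemma greedy {ι β V : Type} [Fintype ι] [Fintype β] [DecidableEq ι] [DecidableEq β] [DecidableEq V]
    (bit : V → β → Bool) (S : Finset V) (Pi : Finset (Finset ((ι × β) × Bool)))
    (α κ : ℝ) (hα0 : 0 < α) (hα1 : α < 1) (hκ0 : 0 < κ) (hκ1 : κ < 1) (E F H : ℕ)
    (hβ : 0 < Fintype.card β) (hH : 4 * Fintype.card β * F ≤ H) (hF : 0 < F)
    (hκ : κ * Fintype.card ι ≤ F) (hL : Pi.card * (1 - κ) ^ (E * F) < 1) :
    ∃ (Sx : ι → Finset V) (Fx : Finset (ι × β)), (∀ i, Sx i ⊆ S) ∧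
      (∀ p ∈ Fx, ∀ u ∈ Sx p.1, ∀ v ∈ Sx p.1, bit u p.2 = bit v p.2) ∧
      (∀ i, α ^ E * (1 - α) ^ (Fintype.card β) * S.card ≤ (Sx i).card) ∧
      ∀ C ∈ Pi, Alive bit Sx C → (C.filter (fun l => l.1 ∉ Fx)).card < H := by
  refine greedy_aux bit S Pi α κ hα0 hα1 hκ0 hκ1 E F H hβ hH hF hκ hL _ (fun _ => S) ∅ (fun _ => 0) le_rfl
    (fun _ => subset_rfl) (by simp) (by simp) (by simp) ?_
  simp only [Finset.sum_const_zero, pow_zero, mul_one]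
  exact_mod_cast Finset.card_filter_le _ _

end CLB


namespace CLB

lemma stable {P V : Type} [DecidableEq P] [DecidableEq V] (R : P → V → Prop) (θ : ℝ) (hθ : 0 ≤ θ) (n : ℕ) :
    ∀ (Q : Finset P) (S : Finset V), Q.card = n → Q.card * θ < S.card →
    ∃ T ⊆ S, T.Nonempty ∧ ∀ p ∈ Q, (T.filter (R p)).Nonempty → θ ≤ (T.filter (R p)).card := by
  induction n with
  | zero =>
    intro Q S hQ hS
    rw [Finset.card_eq_zero] at hQ
    subst hQ
    refine ⟨S, subset_rfl, ?_, by simp⟩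
    rw [← Finset.card_pos]
    simpa using hS
  | succ n ih =>
    intro Q S hQ hS
    by_cases h : ∀ p ∈ Q, (S.filter (R p)).Nonempty → θ ≤ (S.filter (R p)).card
    · refine ⟨S, subset_rfl, ?_, h⟩
      rw [← Finset.card_pos]
      have : (0 : ℝ) < S.card := lt_of_le_of_lt (by positivity) hS
      exact_mod_cast this
    push Not at h
    obtain ⟨p, hp, hne, hlt⟩ := h
    have h1 : (S.filter (R p)).card + (S.filter (fun v => ¬ R p v)).card = S.card :=
      Finset.card_filter_add_card_filter_not _
    have h1' : ((S.filter (R p)).card : ℝ) + (S.filter (fun v => ¬ R p v)).card = S.card := by exact_mod_cast h1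
    have hc : (Q.erase p).card = n := by rw [Finset.card_erase_of_mem hp]; omega
    obtain ⟨T, hT, hTn, hTp⟩ := ih (Q.erase p) (S.filter (fun v => ¬ R p v)) hc (by
      rw [hc]; rw [hQ] at hS; push_cast at hS; linarith)
    refine ⟨T, hT.trans (Finset.filter_subset _ _), hTn, fun p' hp' hne' => ?_⟩
    by_cases hpp : p' = p
    · subst hpp
      obtain ⟨v, hv⟩ := hne'
      rw [Finset.mem_filter] at hv
      exact absurd hv.2 (Finset.mem_filter.1 (hT hv.1)).2
    · exact hTp p' (Finset.mem_erase.2 ⟨hpp, hp'⟩) hne'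

/-- `y` matches the pattern `p` (domain, positive positions). -/
def Match {β V : Type} [DecidableEq β] (bit : V → β → Bool) (p : Finset β × Finset β) (y : V) : Prop :=
  p.1.filter (fun b => bit y b = true) = p.2

noncomputable def cellN {ι β V : Type} [DecidableEq β] (bit : V → β → Bool) (G : SimpleGraph V) (Ti : Finset V)
    (p : Finset β × Finset β) (x : ι → V) (U' : Finset ι) : Finset V :=
  (Ti.filter (Match bit p)).filter (fun y => ∀ j ∈ U', G.Adj (x j) y)

lemma mem_cellN {ι β V : Type} [DecidableEq β] {bit : V → β → Bool} {G : SimpleGraph V} {Ti : Finset V}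
    {p : Finset β × Finset β} {x : ι → V} {U' : Finset ι} {y : V} :
    y ∈ cellN bit G Ti p x U' ↔ (y ∈ Ti ∧ Match bit p y) ∧ ∀ j ∈ U', G.Adj (x j) y := by
  simp only [cellN, Finset.mem_filter]

def Inv {ι β V : Type} [DecidableEq β] (bit : V → β → Bool) (G : SimpleGraph V) (T : ι → Finset V)
    (Q : Finset (Finset β × Finset β)) (δ θ : ℝ) (U : Finset ι) (x : ι → V) : Prop :=
  (∀ i ∈ U, ∀ j ∈ U, i ≠ j → G.Adj (x i) (x j)) ∧
  ∀ U' ⊆ U, ∀ i, ∀ p ∈ Q, ((T i).filter (Match bit p)).Nonempty →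
    δ ^ U'.card * θ ≤ (cellN bit G (T i) p x U').card

lemma Inv.mono {ι β V : Type} [DecidableEq β] {bit : V → β → Bool} {G : SimpleGraph V} {T : ι → Finset V}
    {Q : Finset (Finset β × Finset β)} {δ θ : ℝ} {U U1 : Finset ι} {x : ι → V} (h : Inv bit G T Q δ θ U x)
    (hU : U1 ⊆ U) : Inv bit G T Q δ θ U1 x :=
  ⟨fun i hi j hj => h.1 i (hU hi) j (hU hj), fun U' hU' => h.2 U' (hU'.trans hU)⟩

lemma commit {ι β V : Type} [Fintype ι] [DecidableEq ι] [DecidableEq β] [DecidableEq V]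
    (bit : V → β → Bool) (G : SimpleGraph V) (S : Finset V) (T : ι → Finset V) (hT : ∀ i, T i ⊆ S)
    (Q : Finset (Finset β × Finset β)) (δ θ M : ℝ) (h : ℕ) (hδ : 0 < δ) (hδ1 : δ ≤ 1) (hθ : 0 < θ) (hM : 0 < M)
    (hdens : ∀ A B : Finset V, A ⊆ S → B ⊆ S → M ≤ A.card → M ≤ B.card →
      δ * A.card * B.card ≤ ∑ a ∈ A, ((B.filter (fun b => G.Adj a b)).card : ℝ))
    (hbig : 2 ^ h * (Fintype.card ι : ℝ) * Q.card * M < δ ^ h * θ)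
    (U : Finset ι) (hU : U.card ≤ h) (x : ι → V) (hInv : Inv bit G T Q δ θ U x)
    (i0 : ι) (hi0 : i0 ∉ U) (p0 : Finset β × Finset β) (hp0 : p0 ∈ Q)
    (hne : ((T i0).filter (Match bit p0)).Nonempty) :
    ∃ y ∈ T i0, Match bit p0 y ∧ Inv bit G T Q δ θ (insert i0 U) (Function.update x i0 y) := by
  set Y : Finset ι × ι × (Finset β × Finset β) → Finset V := fun τ =>
    cellN bit G (T τ.2.1) τ.2.2 x τ.1 with hY
  set X := Y (U, i0, p0) with hX
  have hlow : ∀ n, n ≤ h → δ ^ h * θ ≤ δ ^ n * θ := fun n hn => by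
    have := pow_le_pow_of_le_one hδ.le hδ1 hn
    gcongr
  have hXc : δ ^ h * θ ≤ X.card := (hlow _ hU).trans (hInv.2 U subset_rfl i0 p0 hp0 hne)
  have hι : (1 : ℝ) ≤ Fintype.card ι := by
    exact_mod_cast Fintype.card_pos_iff.2 ⟨i0⟩
  have hQ : (1 : ℝ) ≤ Q.card := by exact_mod_cast Finset.card_pos.2 ⟨p0, hp0⟩
  have hMbig : M ≤ δ ^ h * θ := by
    refine le_trans ?_ hbig.le
    have h1 : (1 : ℝ) ≤ 2 ^ h := one_le_pow₀ (by norm_num)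
    have h2 : (1 : ℝ) ≤ 2 ^ h * (Fintype.card ι : ℝ) * Q.card :=
      one_le_mul_of_one_le_of_one_le (one_le_mul_of_one_le_of_one_le h1 hι) hQ
    exact le_mul_of_one_le_left hM.le h2
  set Ts := (U.powerset ×ˢ (Finset.univ : Finset ι) ×ˢ Q).filter
    (fun τ => ((T τ.2.1).filter (Match bit τ.2.2)).Nonempty) with hTs
  set Bad : Finset ι × ι × (Finset β × Finset β) → Finset V := fun τ =>
    X.filter (fun y => (((Y τ).filter (fun b => G.Adj y b)).card : ℝ) < δ * (Y τ).card) with hBad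
  have hYS : ∀ τ, Y τ ⊆ S := fun τ =>
    fun y hy => hT _ (mem_cellN.1 hy).1.1
  have hYc : ∀ τ ∈ Ts, M ≤ (Y τ).card := by
    intro τ hτ
    simp only [hTs, Finset.mem_filter, Finset.mem_product, Finset.mem_powerset] at hτ
    refine (hMbig.trans (hlow τ.1.card ?_)).trans (hInv.2 τ.1 hτ.1.1 τ.2.1 τ.2.2 hτ.1.2.2 hτ.2)
    exact (Finset.card_le_card hτ.1.1).trans hU
  have hBadc : ∀ τ ∈ Ts, ((Bad τ).card : ℝ) ≤ M := by
    intro τ hτ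
    by_contra hcon
    push Not at hcon
    have h1 := hdens (Bad τ) (Y τ) ((Finset.filter_subset _ _).trans (hYS _)) (hYS _) hcon.le (hYc τ hτ)
    have hBne : (Bad τ).Nonempty := by
      rw [← Finset.card_pos]
      have : (0 : ℝ) < (Bad τ).card := hM.trans hcon
      exact_mod_cast this
    have h2 : ∑ a ∈ Bad τ, (((Y τ).filter (fun b => G.Adj a b)).card : ℝ) < ∑ a ∈ Bad τ, δ * (Y τ).card :=
      Finset.sum_lt_sum_of_nonempty hBne (fun a ha => (Finset.mem_filter.1 ha).2)
    rw [Finset.sum_const, nsmul_eq_mul] at h2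
    linarith
  have hex : ∃ y ∈ X, ∀ τ ∈ Ts, y ∉ Bad τ := by
    by_contra hcon
    push Not at hcon
    have h1 : X ⊆ Ts.biUnion Bad := fun y hy => by
      rw [Finset.mem_biUnion]; exact hcon y hy
    have h2 : (X.card : ℝ) ≤ Ts.card * M := by
      have h3 := (Finset.card_le_card h1).trans Finset.card_biUnion_le
      calc (X.card : ℝ) ≤ ∑ τ ∈ Ts, ((Bad τ).card : ℝ) := by exact_mod_cast h3
        _ ≤ ∑ τ ∈ Ts, M := Finset.sum_le_sum hBadc
        _ = _ := by rw [Finset.sum_const, nsmul_eq_mul]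
    have h3 : (Ts.card : ℝ) ≤ 2 ^ h * (Fintype.card ι : ℝ) * Q.card := by
      have : Ts.card ≤ 2 ^ h * (Fintype.card ι * Q.card) := by
        refine (Finset.card_filter_le _ _).trans ?_
        rw [Finset.card_product, Finset.card_product, Finset.card_powerset, Finset.card_univ]
        gcongr
        norm_num
      have h4 : (Ts.card : ℝ) ≤ 2 ^ h * ((Fintype.card ι : ℝ) * Q.card) := by exact_mod_cast this
      linarith
    have h4 : (Ts.card : ℝ) * M ≤ 2 ^ h * (Fintype.card ι : ℝ) * Q.card * M := by gcongr
    linarith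
  obtain ⟨y, hyX, hy⟩ := hex
  have hyX' := hyX
  simp only [hX, hY, mem_cellN] at hyX'
  obtain ⟨⟨hyT, hym⟩, hyadj⟩ := hyX'
  refine ⟨y, hyT, hym, ?_, ?_⟩
  · intro i hi j hj hij
    rw [Finset.mem_insert] at hi hj
    have hupd : ∀ j ∈ U, Function.update x i0 y j = x j := fun j (hj : j ∈ U) =>
      Function.update_of_ne (by intro hjj; rw [hjj] at hj; exact hi0 hj) _ _
    rcases hi with rfl | hi <;> rcases hj with rfl | hj
    · exact absurd rfl hij
    · rw [Function.update_self, hupd j hj]; exact (hyadj j hj).symm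
    · rw [Function.update_self, hupd i hi]; exact hyadj i hi
    · rw [hupd i hi, hupd j hj]; exact hInv.1 i hi j hj hij
  · intro U' hU' i p hp hnep
    have hUe : U'.erase i0 ⊆ U := by
      intro j hj
      rw [Finset.mem_erase] at hj
      rcases Finset.mem_insert.1 (hU' hj.2) with h | h
      · exact absurd h hj.1
      · exact h
    have hupd : ∀ j ∈ U'.erase i0, Function.update x i0 y j = x j := fun j hj =>
      Function.update_of_ne (Finset.mem_erase.1 hj).1 _ _
    by_cases hmem : i0 ∈ U'
    · have hτ : (U'.erase i0, i, p) ∈ Ts := by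
        simp only [hTs, Finset.mem_filter, Finset.mem_product, Finset.mem_powerset, Finset.mem_univ, true_and]
        exact ⟨⟨hUe, hp⟩, hnep⟩
      have h1 := hy _ hτ
      have h2 : δ * (Y (U'.erase i0, i, p)).card ≤ ((Y (U'.erase i0, i, p)).filter (fun b => G.Adj y b)).card := by
        by_contra hc
        push Not at hc
        exact h1 (Finset.mem_filter.2 ⟨hyX, hc⟩)
      have h3 := hInv.2 (U'.erase i0) hUe i p hp hnep
      have h4 : (Y (U'.erase i0, i, p)).filter (fun b => G.Adj y b) ⊆
          cellN bit G (T i) p (Function.update x i0 y) U' := by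
        intro z hz
        simp only [hY, Finset.mem_filter, mem_cellN] at hz
        rw [mem_cellN]
        refine ⟨hz.1.1, fun j hj => ?_⟩
        by_cases hji : j = i0
        · subst hji; rw [Function.update_self]; exact hz.2
        · have hj' : j ∈ U'.erase i0 := Finset.mem_erase.2 ⟨hji, hj⟩
          rw [hupd j hj']; exact hz.1.2 j hj'
      have h5 : (((Y (U'.erase i0, i, p)).filter (fun b => G.Adj y b)).card : ℝ) ≤
          (cellN bit G (T i) p (Function.update x i0 y) U').card := by
        exact_mod_cast Finset.card_le_card h4
      have h6 : U'.card = (U'.erase i0).card + 1 := (Finset.card_erase_add_one hmem).symm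
      rw [h6]
      calc _ = δ * (δ ^ (U'.erase i0).card * θ) := by ring
        _ ≤ δ * (Y (U'.erase i0, i, p)).card := by gcongr
        _ ≤ _ := h2.trans h5
    · rw [Finset.erase_eq_of_notMem hmem] at hUe hupd
      have h3 := hInv.2 U' hUe i p hp hnep
      refine h3.trans ?_
      have : cellN bit G (T i) p x U' ⊆
          cellN bit G (T i) p (Function.update x i0 y) U' := by
        intro z hz
        rw [mem_cellN] at hz ⊢
        exact ⟨hz.1, fun j hj => by rw [hupd j hj]; exact hz.2 j hj⟩
      exact_mod_cast Finset.card_le_card this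

/-- Free bits of index `i` mentioned by the clause. -/
noncomputable def fb {ι β : Type} [Fintype β] (Fx : Finset (ι × β)) (C : Finset ((ι × β) × Bool)) (i : ι) : Finset β :=
  Finset.univ.filter (fun b => (i, b) ∉ Fx ∧ ∃ a, ((i, b), a) ∈ C)

/-- Indices with many free bits mentioned by the clause. -/
noncomputable def heavy {ι β : Type} [Fintype ι] [Fintype β] (Fx : Finset (ι × β)) (w : ℕ)
    (C : Finset ((ι × β) × Bool)) : Finset ι :=
  Finset.univ.filter (fun i => w ≤ (fb Fx C i).card)

lemma mem_fb {ι β : Type} [Fintype β] {Fx : Finset (ι × β)} {C : Finset ((ι × β) × Bool)} {i : ι} {b : β} :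
    b ∈ fb Fx C i ↔ (i, b) ∉ Fx ∧ ∃ a, ((i, b), a) ∈ C := by
  simp only [fb, Finset.mem_filter, Finset.mem_univ, true_and]

lemma mem_heavy {ι β : Type} [Fintype ι] [Fintype β] {Fx : Finset (ι × β)} {w : ℕ}
    {C : Finset ((ι × β) × Bool)} {i : ι} : i ∈ heavy Fx w C ↔ w ≤ (fb Fx C i).card := by
  simp only [heavy, Finset.mem_filter, Finset.mem_univ, true_and]

lemma heavy_card {ι β : Type} [Fintype ι] [Fintype β] [DecidableEq ι] [DecidableEq β] (Fx : Finset (ι × β)) (w : ℕ)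
    (C : Finset ((ι × β) × Bool)) :
    (heavy Fx w C).card * w ≤ (C.filter (fun l => l.1 ∉ Fx)).card := by
  calc (heavy Fx w C).card * w = ∑ i ∈ heavy Fx w C, w := by simp
    _ ≤ ∑ i ∈ heavy Fx w C, (fb Fx C i).card := Finset.sum_le_sum (fun i hi => (Finset.mem_filter.1 hi).2)
    _ = ((heavy Fx w C).sigma (fb Fx C)).card := (Finset.card_sigma _ _).symm
    _ ≤ ((C.filter (fun l => l.1 ∉ Fx)).image Prod.fst).card := by
      refine Finset.card_le_card_of_injOn (fun s => (s.1, s.2)) ?_ ?_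
      · rintro ⟨i, b⟩ hs
        have h1 := (Finset.mem_sigma.1 hs).2
        simp only [fb, Finset.mem_filter, Finset.mem_univ, true_and] at h1
        obtain ⟨h2, a, ha⟩ := h1
        exact Finset.mem_coe.2 (Finset.mem_image.2 ⟨((i, b), a), Finset.mem_filter.2 ⟨ha, h2⟩, rfl⟩)
      · rintro ⟨i, b⟩ _ ⟨i', b'⟩ _ h
        simp only [Prod.mk.injEq] at h
        obtain ⟨rfl, rfl⟩ := h
        rfl
    _ ≤ _ := Finset.card_image_le

/-- The Adversary's walk through the refutation. -/
lemma walk {ι β V : Type} [Fintype ι] [Fintype β] [DecidableEq ι] [DecidableEq β] [DecidableEq V]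
    (bit : V → β → Bool) (G : SimpleGraph V) (S : Finset V) (Sx T : ι → Finset V) (hT : ∀ i, T i ⊆ Sx i)
    (hSx : ∀ i, Sx i ⊆ S) (Fx : Finset (ι × β))
    (hFx : ∀ p ∈ Fx, ∀ u ∈ Sx p.1, ∀ v ∈ Sx p.1, bit u p.2 = bit v p.2)
    (Q : Finset (Finset β × Finset β)) (δ θ M : ℝ) (h w : ℕ) (hw : 0 < w)
    (hQ : ∀ D P : Finset β, D.card ≤ w → P.card ≤ w → (D, P) ∈ Q)
    (hδ : 0 < δ) (hδ1 : δ ≤ 1) (hθ : 0 < θ) (hM : 0 < M)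
    (hdens : ∀ A B : Finset V, A ⊆ S → B ⊆ S → M ≤ A.card → M ≤ B.card →
      δ * A.card * B.card ≤ ∑ a ∈ A, ((B.filter (fun b => G.Adj a b)).card : ℝ))
    (hbig : 2 ^ h * (Fintype.card ι : ℝ) * Q.card * M < δ ^ h * θ)
    (hTne : ∀ i, (T i).Nonempty)
    (hTst : ∀ i, ∀ p ∈ Q, ((T i).filter (Match bit p)).Nonempty → θ ≤ ((T i).filter (Match bit p)).card)
    (hfree : ∀ i, w ≤ (Finset.univ.filter (fun b => (i, b) ∉ Fx)).card)
    (φ : Set (Finset ((ι × β) × Bool)))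
    (hax : ∀ C ∈ φ, ∀ x : ι → V, (∀ l ∈ C, bit (x l.1.1) l.1.2 ≠ l.2) →
      ∃ i j, i ≠ j ∧ ¬ G.Adj (x i) (x j) ∧ ∀ b, (∃ a, ((i, b), a) ∈ C) ∧ (∃ a, ((j, b), a) ∈ C))
    (N : ℕ) (Cl : ℕ → Finset ((ι × β) × Bool)) (hN : Cl N = ∅)
    (hthin : ∀ n ≤ N, Alive bit Sx (Cl n) → ((Cl n).filter (fun l => l.1 ∉ Fx)).card < w * h)
    (hvalid : ∀ n ≤ N, Cl n ∈ φ ∨ ∃ j k, j < n ∧ k < n ∧ ∃ v : ι × β,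
      (∀ l ∈ Cl j, l = (v, true) ∨ l ∈ Cl n) ∧ (∀ l ∈ Cl k, l = (v, false) ∨ l ∈ Cl n)) : False := by
  have main : ∀ n, n ≤ N → ∀ x : ι → V, (∀ i, x i ∈ T i) → (∀ l ∈ Cl n, bit (x l.1.1) l.1.2 ≠ l.2) →
      Inv bit G T Q δ θ (heavy Fx w (Cl n)) x → False := by
    intro n
    induction n using Nat.strong_induction_on with
    | _ n ih =>
    intro hn x hx hfal hInv
    -- the thin bound
    have hal : Alive bit Sx (Cl n) := fun l hl => ⟨x l.1.1, hT _ (hx _), hfal l hl⟩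
    have hthn := hthin n hn hal
    have hU : (heavy Fx w (Cl n)).card ≤ h := by
      have h1 := heavy_card Fx w (Cl n)
      by_contra hc
      push Not at hc
      have : w * h ≤ (heavy Fx w (Cl n)).card * w := by rw [mul_comm]; gcongr
      omega
    have step : ∀ j < n, ∀ (v : ι × β) (a : Bool), (∀ l ∈ Cl j, l = (v, a) ∨ l ∈ Cl n) →
        bit (x v.1) v.2 ≠ a → False := by
      intro j hj v a hsub hva
      have hfalj : ∀ l ∈ Cl j, bit (x l.1.1) l.1.2 ≠ l.2 := by
        intro l hl
        rcases hsub l hl with rfl | hl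
        · exact hva
        · exact hfal l hl
      have hfb : ∀ i, i ≠ v.1 → fb Fx (Cl j) i ⊆ fb Fx (Cl n) i := by
        intro i hi b hb
        simp only [fb, Finset.mem_filter, Finset.mem_univ, true_and] at hb ⊢
        refine ⟨hb.1, ?_⟩
        obtain ⟨a', ha'⟩ := hb.2
        rcases hsub _ ha' with h1 | h1
        · exact absurd (congrArg (fun l => l.1.1) h1) hi
        · exact ⟨a', h1⟩
      have hfb' : fb Fx (Cl j) v.1 ⊆ insert v.2 (fb Fx (Cl n) v.1) := by
        intro b hb
        simp only [fb, Finset.mem_insert, Finset.mem_filter, Finset.mem_univ, true_and] at hb ⊢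
        obtain ⟨a', ha'⟩ := hb.2
        rcases hsub _ ha' with h1 | h1
        · left; exact congrArg (fun l => l.1.2) h1
        · exact Or.inr ⟨hb.1, a', h1⟩
      have hheavy : heavy Fx w (Cl j) ⊆ insert v.1 (heavy Fx w (Cl n)) := by
        intro i hi
        rw [Finset.mem_insert]
        by_cases hiv : i = v.1
        · exact Or.inl hiv
        · right
          simp only [heavy, Finset.mem_filter, Finset.mem_univ, true_and] at hi ⊢
          exact hi.trans (Finset.card_le_card (hfb i hiv))
      by_cases hv : v.1 ∈ heavy Fx w (Cl n)
      · rw [Finset.insert_eq_of_mem hv] at hheavy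
        exact ih j hj (by omega) x hx hfalj (hInv.mono hheavy)
      · set D := fb Fx (Cl j) v.1 with hD
        have hDc : D.card ≤ w := by
          have h1 := (Finset.card_le_card hfb').trans (Finset.card_insert_le _ _)
          simp only [heavy, Finset.mem_filter, Finset.mem_univ, true_and] at hv
          omega
        obtain ⟨y, hyT, hym, hyInv⟩ := commit bit G S T (fun i => (hT i).trans (hSx i)) Q δ θ M h hδ hδ1 hθ hM hdens hbig
          _ hU x hInv v.1 hv (D, D.filter (fun b => bit (x v.1) b = true))
          (hQ _ _ hDc ((Finset.card_filter_le _ _).trans hDc))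
          ⟨x v.1, Finset.mem_filter.2 ⟨hx _, rfl⟩⟩
        refine ih j hj (by omega) (Function.update x v.1 y) ?_ ?_ (hyInv.mono hheavy)
        · intro i
          by_cases hi : i = v.1
          · subst hi; rw [Function.update_self]; exact hyT
          · rw [Function.update_of_ne hi]; exact hx i
        · rintro ⟨⟨i, b⟩, a'⟩ hl
          have h1 := hfalj _ hl
          simp only at h1 ⊢
          by_cases hi : i = v.1
          · subst hi
            rw [Function.update_self]
            have heq : bit y b = bit (x v.1) b := by
              by_cases hbF : (v.1, b) ∈ Fx
              · exact hFx _ hbF y (hT _ hyT) _ (hT _ (hx _))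
              · have hbD : b ∈ D := by
                  simp only [hD, fb, Finset.mem_filter, Finset.mem_univ, true_and]
                  exact ⟨hbF, a', hl⟩
                unfold Match at hym
                have h2 := Finset.ext_iff.1 hym b
                simp only [Finset.mem_filter, hbD, true_and] at h2
                exact Bool.eq_iff_iff.2 h2
            rw [heq]; exact h1
          · rw [Function.update_of_ne hi]; exact h1
    rcases hvalid n hn with hφ | ⟨j, k, hj, hk, v, h1, h2⟩
    · obtain ⟨i, j, hij, hadj, hvar⟩ := hax _ hφ x hfal
      have hh : ∀ i, (∀ b, ∃ a, ((i, b), a) ∈ Cl n) → i ∈ heavy Fx w (Cl n) := by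
        intro i hi
        rw [mem_heavy]
        refine (hfree i).trans (Finset.card_le_card ?_)
        intro b hb
        rw [Finset.mem_filter] at hb
        rw [mem_fb]
        exact ⟨hb.2, hi b⟩
      exact hadj (hInv.1 i (hh i fun b => (hvar b).1) j (hh j fun b => (hvar b).2) hij)
    · by_cases hb : bit (x v.1) v.2 = true
      · exact step k hk v false h2 (by simp [hb])
      · exact step j hj v true h1 hb
  choose x hx using hTne
  refine main N le_rfl x hx (by simp [hN]) ?_
  have hemp : heavy Fx w (Cl N) = ∅ := by
    rw [Finset.eq_empty_iff_forall_notMem]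
    intro i hi
    have h1 : fb Fx (Cl N) i = ∅ := by
      rw [Finset.eq_empty_iff_forall_notMem]
      intro b hb
      rw [mem_fb, hN] at hb
      simp at hb
    rw [mem_heavy, h1, Finset.card_empty] at hi
    omega
  rw [hemp]
  refine ⟨by simp, fun U' hU' i p hp hne => ?_⟩
  rw [Finset.subset_empty] at hU'
  subst hU'
  have h1 : cellN bit G (T i) p x ∅ = (T i).filter (Match bit p) := by
    ext y; simp [mem_cellN]
  rw [h1]
  simpa using hTst i p hp hne

end CLB


namespace CLB

lemma vbit_inj {k : ℕ} {u v : Fin (2 ^ k)} (h : ∀ b, vbit u b = vbit v b) : u = v := by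
  apply Fin.ext
  apply Nat.eq_of_testBit_eq
  intro i
  by_cases hi : i < k
  · exact h ⟨i, hi⟩
  · push Not at hi
    have h2 : 2 ^ k ≤ 2 ^ i := Nat.pow_le_pow_right (by norm_num) hi
    rw [Nat.testBit_lt_two_pow (u.2.trans_le h2), Nat.testBit_lt_two_pow (v.2.trans_le h2)]

lemma neq_false {c : ℝ} {k : ℕ} {i : Fin (numIdx c k)} {v : Fin (2 ^ k)} {x : Fin (numIdx c k) → Fin (2 ^ k)}
    (h : ∀ l ∈ neqClause c k i v, vbit (x l.1.1) l.1.2 ≠ l.2) : x i = v := by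
  apply vbit_inj
  intro b
  have h1 := h ((i, b), ! vbit v b) (by simp [neqClause])
  simpa using h1

lemma clause_falsified {c : ℝ} {k : ℕ} (G : SimpleGraph (Fin (2 ^ k))) (C : Clause (CliqueVar c k))
    (hC : C ∈ CliqueCNF c G) (x : Fin (numIdx c k) → Fin (2 ^ k))
    (hx : ∀ l ∈ C, vbit (x l.1.1) l.1.2 ≠ l.2) :
    ∃ i j, i ≠ j ∧ ¬ G.Adj (x i) (x j) ∧ ∀ b, (∃ a, ((i, b), a) ∈ C) ∧ (∃ a, ((j, b), a) ∈ C) := by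
  have key : ∀ (i j : Fin (numIdx c k)) (u v : Fin (2 ^ k)), i ≠ j → ¬ G.Adj u v →
      C = neqClause c k i u ∪ neqClause c k j v →
      ∃ i j, i ≠ j ∧ ¬ G.Adj (x i) (x j) ∧ ∀ b, (∃ a, ((i, b), a) ∈ C) ∧ (∃ a, ((j, b), a) ∈ C) := by
    intro i j u v hij hadj hCe
    subst hCe
    have h1 : x i = u := neq_false fun l hl => hx l (Finset.mem_union_left _ hl)
    have h2 : x j = v := neq_false fun l hl => hx l (Finset.mem_union_right _ hl)
    refine ⟨i, j, hij, by rw [h1, h2]; exact hadj, fun b => ⟨⟨! vbit u b, ?_⟩, ⟨! vbit v b, ?_⟩⟩⟩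
    · exact Finset.mem_union_left _ (by simp [neqClause])
    · exact Finset.mem_union_right _ (by simp [neqClause])
  rcases hC with ⟨i, j, hij, v, h⟩ | ⟨i, j, hij, u, v, _, hadj, h⟩
  · exact key i j v v hij (G.loopless.irrefl v) h
  · exact key i j u v hij hadj h

lemma free_bits {c : ℝ} {k : ℕ} (Fx : Finset (Fin (numIdx c k) × Fin k)) (i : Fin (numIdx c k))
    (A : Finset (Fin (2 ^ k))) (hA : ∀ b, (i, b) ∈ Fx → ∀ u ∈ A, ∀ v ∈ A, vbit u b = vbit v b) (s : ℕ)
    (hs : 2 ^ s ≤ A.card) : s ≤ (Finset.univ.filter (fun b => (i, b) ∉ Fx)).card := by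
  have h1 : A.card ≤ (Finset.univ.filter (fun b => (i, b) ∉ Fx)).powerset.card := by
    refine Finset.card_le_card_of_injOn
      (fun v => (Finset.univ.filter (fun b => (i, b) ∉ Fx)).filter (fun b => vbit v b = true)) ?_ ?_
    · intro v _
      exact Finset.mem_coe.2 (Finset.mem_powerset.2 (Finset.filter_subset _ _))
    · intro u hu v hv huv
      apply vbit_inj
      intro b
      by_cases hb : (i, b) ∈ Fx
      · exact hA b hb u hu v hv
      · have h2 := Finset.ext_iff.1 huv b
        simp only [Finset.mem_filter, Finset.mem_univ, true_and, hb, not_false_eq_true] at h2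
        exact Bool.eq_iff_iff.2 h2
  rw [Finset.card_powerset] at h1
  exact (Nat.pow_le_pow_iff_right (by norm_num)).1 (hs.trans h1)

lemma core (c : ℝ) (k : ℕ) (G : SimpleGraph (Fin (2 ^ k))) (R : Refutation (CliqueCNF c G))
    (S : Finset (Fin (2 ^ k))) (δ M α κ θ : ℝ) (s F : ℕ) (hk : 0 < k) (hs : 0 < s) (hF : 0 < F)
    (hδ : 0 < δ) (hδ1 : δ ≤ 1) (hM : 0 < M) (hα : 0 < α) (hα1 : α < 1) (hκ : 0 < κ) (hκ1 : κ < 1) (hθ : 0 < θ)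
    (hFs : 4 * k * F ≤ s * s) (hκF : κ * numIdx c k ≤ F)
    (hR : (R.length : ℝ) * (1 - κ) ^ (s * F) < 1)
    (hdens : ∀ A B : Finset (Fin (2 ^ k)), A ⊆ S → B ⊆ S → M ≤ A.card → M ≤ B.card →
      δ * A.card * B.card ≤ ∑ a ∈ A, ((B.filter (fun b => G.Adj a b)).card : ℝ))
    (q : ℝ) (hq : (((Finset.univ : Finset (Fin k)).powerset.filter (fun J => J.card ≤ s)).card : ℝ) ≤ q)
    (hqθ : q * q * θ < α ^ s * (1 - α) ^ k * S.card)
    (hbig : 2 ^ s * (numIdx c k : ℝ) * (q * q) * M < δ ^ s * θ)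
    (hfr : (2 : ℝ) ^ s ≤ α ^ s * (1 - α) ^ k * S.card) : False := by
  obtain ⟨Sx, Fx, hSx, hFx, hSxc, hthin⟩ := greedy (ι := Fin (numIdx c k)) (β := Fin k) vbit S R.clauses.toFinset
    α κ hα hα1 hκ hκ1 s F (s * s) (by simpa using hk) (by simpa using hFs) hF (by simpa using hκF) (by
      refine lt_of_le_of_lt ?_ hR
      have h1 : (R.clauses.toFinset.card : ℝ) ≤ R.length := by
        exact_mod_cast List.toFinset_card_le R.clauses
      have h2 : 0 ≤ 1 - κ := by linarith
      gcongr)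
  rw [Fintype.card_fin] at hSxc
  set P := (Finset.univ : Finset (Fin k)).powerset.filter (fun J => J.card ≤ s) with hP
  have hQc : ((P ×ˢ P).card : ℝ) ≤ q * q := by
    rw [Finset.card_product]
    push_cast
    have hq0 : 0 ≤ q := le_trans (by positivity) hq
    gcongr
  have hTex : ∀ i, ∃ T ⊆ Sx i, T.Nonempty ∧ ∀ p ∈ P ×ˢ P, (T.filter (Match vbit p)).Nonempty →
      θ ≤ (T.filter (Match vbit p)).card := by
    intro i
    refine stable (Match vbit) θ hθ.le _ (P ×ˢ P) (Sx i) rfl ?_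
    refine lt_of_lt_of_le (lt_of_le_of_lt ?_ hqθ) (hSxc i)
    gcongr
  choose T hT hTne hTst using hTex
  have hlen : 0 < R.clauses.length := List.length_pos_iff.2 R.nonempty
  have hgd : ∀ n, (hn : n < R.clauses.length) → R.clauses.getD n ∅ = R.clauses.get ⟨n, hn⟩ := by
    intro n hn
    simp [List.getD, hn]
  refine walk vbit G S Sx T hT hSx Fx hFx (P ×ˢ P) δ θ M s s hs ?_ hδ hδ1 hθ hM hdens ?_ hTne hTst ?_
    (CliqueCNF c G) (fun C hC x hx => clause_falsified G C hC x hx) (R.clauses.length - 1)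
    (fun n => R.clauses.getD n ∅) ?_ ?_ ?_
  · intro D P' hD hP'
    simp [hP, hD, hP']
  · rw [Fintype.card_fin]
    refine lt_of_le_of_lt ?_ hbig
    gcongr
  · intro i
    refine free_bits Fx i (Sx i) (fun b hb u hu v hv => hFx (i, b) hb u hu v hv) s ?_
    have := hfr.trans (hSxc i)
    exact_mod_cast this
  · have h1 := R.last_empty
    rw [List.getLast_eq_getElem] at h1
    rw [hgd _ (by omega)]
    exact h1
  · intro n hn hal
    rw [hgd n (by omega)] at hal ⊢
    exact hthin _ (List.mem_toFinset.2 (List.get_mem _ _)) hal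
  · intro n hn
    rw [hgd n (by omega)]
    rcases R.valid ⟨n, by omega⟩ with h | ⟨j, k', hj, hk', v, A, B, hA, hB, hAB⟩
    · exact Or.inl h
    · right
      refine ⟨j, k', hj, hk', v, ?_, ?_⟩
      · rw [hgd _ j.2, hAB]
        intro l hl
        have hl' : l ∈ R.clauses.get j := hl
        rw [hA, Finset.mem_insert] at hl'
        exact hl'.imp id (fun h => Finset.mem_union_left _ h)
      · rw [hgd _ k'.2, hAB]
        intro l hl
        have hl' : l ∈ R.clauses.get k' := hl
        rw [hB, Finset.mem_insert] at hl'
        exact hl'.imp id (fun h => Finset.mem_union_right _ h)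

end CLB


namespace CLB

lemma arith (ρ n B m a t d : ℝ) (hρ : 1 < ρ) (hn : ρ ^ 3 ≤ n) (hB : ρ ^ 10 ≤ B) (hm : 0 ≤ m) (hm2 : 2 * m < ρ)
    (ha : 1 / ρ ≤ a) (ht0 : 0 < t) (ht : t ≤ ρ) (hd : 1 / ρ ≤ d) :
    ρ * ρ * (n / (2 * ρ ^ 4)) < a * (1 / ρ) * n ∧ t * m * (ρ * ρ) * (n / B) < d * (n / (2 * ρ ^ 4)) ∧
      t ≤ a * (1 / ρ) * n := by
  have hρ0 : 0 < ρ := by linarith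
  have hn0 : 0 < n := lt_of_lt_of_le (by positivity) hn
  have hB0 : 0 < B := lt_of_lt_of_le (by positivity) hB
  have hX : n / ρ ^ 2 ≤ a * (1 / ρ) * n := by
    calc n / ρ ^ 2 = (1 / ρ) * (1 / ρ) * n := by field_simp
      _ ≤ _ := by gcongr
  refine ⟨lt_of_lt_of_le ?_ hX, ?_, le_trans ?_ hX⟩
  · have : ρ * ρ * (n / (2 * ρ ^ 4)) = n / ρ ^ 2 / 2 := by field_simp
    rw [this]
    exact half_lt_self (by positivity)
  · calc t * m * (ρ * ρ) * (n / B) ≤ ρ * m * (ρ * ρ) * (n / ρ ^ 10) := by gcongr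
      _ = (2 * m) * (n / (2 * ρ ^ 7)) := by field_simp
      _ < ρ ^ 2 * (n / (2 * ρ ^ 7)) := by
        have : 0 < n / (2 * ρ ^ 7) := by positivity
        have h2 : ρ ≤ ρ ^ 2 := by nlinarith
        apply mul_lt_mul_of_pos_right (by linarith) this
      _ = (1 / ρ) * (n / (2 * ρ ^ 4)) := by field_simp
      _ ≤ _ := by gcongr
  · rw [le_div_iff₀ (by positivity)]
    calc t * ρ ^ 2 ≤ ρ * ρ ^ 2 := by gcongr
      _ = ρ ^ 3 := by ring
      _ ≤ n := hn

lemma len_small (t y L : ℝ) (z : ℕ) (ht : 0 < t) (ht1 : t < 1) (hz : y ≤ z)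
    (hL : L < (2 : ℝ) ^ (Real.logb 2 (1 / t) * y)) : L * t ^ z < 1 := by
  rw [Real.rpow_mul (by norm_num), Real.rpow_logb (by norm_num) (by norm_num) (by positivity)] at hL
  have h1 : t ^ z ≤ t ^ y := by
    rw [← Real.rpow_natCast]
    exact Real.rpow_le_rpow_of_exponent_ge ht ht1.le hz
  have h2 : (1 / t) ^ y * t ^ y = 1 := by
    rw [← Real.mul_rpow (by positivity) ht.le, one_div_mul_cancel ht.ne', Real.one_rpow]
  have h3 : 0 < t ^ z := by positivity
  have h4 : 0 < (1 / t) ^ y := by positivity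
  calc L * t ^ z < (1 / t) ^ y * t ^ z := by gcongr
    _ ≤ (1 / t) ^ y * t ^ y := by gcongr
    _ = 1 := h2

end CLB
/-- Fix `c > 0`. There is `ε' > 0` such that for every sufficiently
large `k` and every `c`-Ramsey graph `G` on `n = 2^k` vertices, every resolution
refutation of `Clique(G)` has length at least `2^(ε'·k²)`, which is `n^(Ω(log₂ n))`. -/
theorem clique_length_lower_bound (c : ℝ) (hc : 0 < c) :
    ∃ ε' : ℝ, 0 < ε' ∧ ∃ K : ℕ, ∀ k : ℕ, K ≤ k →
      ∀ G : SimpleGraph (Fin (2 ^ k)), IsCRamsey c G →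
        ∀ R : Refutation (CliqueCNF c G), (2 : ℝ) ^ (ε' * (k : ℝ) ^ 2) ≤ (R.length : ℝ) := by
  obtain ⟨C, hC⟩ := exists_nat_ge (c + 1)
  have hC1 : (1 : ℝ) ≤ C := by linarith
  obtain ⟨b, δ, hb, hδ, hδ1, K1, hK1⟩ := CLB.density_lemma C
  obtain ⟨r, hr, hr10⟩ := CLB.exists_root (min b (4 / 3)) (lt_min hb (by norm_num)) 10
  have hrb : r ^ 10 ≤ b := hr10.trans (min_le_left _ _)
  have hr43 : r ^ 3 ≤ 3 / 2 :=
    (pow_le_pow_right₀ hr.le (by norm_num)).trans ((hr10.trans (min_le_right _ _)).trans (by norm_num))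
  have hr0 : 0 < r := by linarith
  set α : ℝ := 1 - 1 / r with hαdef
  have hinv : 1 / r < 1 := by rw [div_lt_one hr0]; exact hr
  have hinv0 : 0 < 1 / r := by positivity
  have hα : 0 < α := by rw [hαdef]; linarith
  have hα1 : α < 1 := by rw [hαdef]; linarith
  have hα' : 1 - α = 1 / r := by rw [hαdef]; ring
  set A : ℝ := 2 + 1 / α + 1 / δ with hA
  have h1α : 0 < 1 / α := by positivity
  have h1δ : 0 < 1 / δ := by positivity
  obtain ⟨ε1, hε1, hpow⟩ := CLB.pow_small A (by positivity) r hr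
  obtain ⟨ε2, hε2, hfew⟩ := CLB.few_small r hr
  obtain ⟨K2, hK2⟩ := CLB.eventually_lin (2 * C) r hr
  obtain ⟨ε, hε, hεε1, hεε2, hε1'⟩ : ∃ ε : ℝ, 0 < ε ∧ ε ≤ ε1 ∧ ε ≤ ε2 ∧ ε ≤ 1 :=
    ⟨min (min ε1 ε2) 1, by positivity, (min_le_left _ _).trans (min_le_left _ _),
      (min_le_left _ _).trans (min_le_right _ _), min_le_right _ _⟩
  set f : ℝ := ε ^ 2 / 16 with hf
  have hf0 : 0 < f := by positivity
  have hf1 : f < 1 := by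
    have : ε ^ 2 ≤ 1 := pow_le_one₀ hε.le hε1'
    rw [hf]; linarith
  set κ : ℝ := f / (2 * C) with hκdef
  have hC0 : (0 : ℝ) < C := by linarith
  have hκ : 0 < κ := by positivity
  have hκ1 : κ < 1 := by
    rw [hκdef, div_lt_one (by positivity)]; linarith
  have ht1 : 0 < 1 - κ := by linarith
  refine ⟨Real.logb 2 (1 / (1 - κ)) * (ε * f / 4), ?_, max (max K1 K2) (max ⌈2 / f⌉₊ (max ⌈2 / ε⌉₊ 1)), ?_⟩
  · apply mul_pos
    · apply Real.logb_pos (by norm_num)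
      rw [lt_div_iff₀ ht1]; linarith
    · positivity
  intro k hk G hG R
  simp only [max_le_iff] at hk
  obtain ⟨⟨hkK1, hkK2⟩, hkf, hke, hk1⟩ := hk
  have hk0 : (0 : ℝ) < k := by exact_mod_cast hk1
  have hfk : 2 ≤ f * k := by
    have := (Nat.le_ceil _).trans (Nat.cast_le.2 hkf : ((⌈2 / f⌉₊ : ℕ) : ℝ) ≤ k)
    rw [div_le_iff₀ hf0] at this; linarith
  have hek : 2 ≤ ε * k := by
    have := (Nat.le_ceil _).trans (Nat.cast_le.2 hke : ((⌈2 / ε⌉₊ : ℕ) : ℝ) ≤ k)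
    rw [div_le_iff₀ hε] at this; linarith
  by_contra hL
  push Not at hL
  have hmR : c * (k : ℝ) ≤ ((C * k : ℕ) : ℝ) := by
    push_cast
    have : c ≤ C := by linarith
    gcongr
  have hm : numIdx c k ≤ C * k := Nat.ceil_le.2 hmR
  have hlog : Real.logb 2 ((2 ^ k : ℕ) : ℝ) = k := by
    push_cast
    rw [Real.logb_pow, Real.logb_self_eq_one (by norm_num), mul_one]
  unfold IsCRamsey at hG
  rw [hlog] at hG
  obtain ⟨S, hSc, hdens⟩ := hK1 k hkK1 G (numIdx c k) hm
    (fun T hT hcl => hG ⟨T, hT, Or.inl hcl⟩) (fun T hT hcl => hG ⟨T, hT, Or.inr hcl⟩)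
  set s := ⌊ε * k⌋₊ with hs
  set F := ⌊f * k⌋₊ with hF
  have hs1 : (s : ℝ) ≤ ε * k := Nat.floor_le (by positivity)
  have hs2 : ε * k / 2 ≤ s := by
    have := Nat.lt_floor_add_one (ε * k)
    rw [← hs] at this
    linarith
  have hF1 : (F : ℝ) ≤ f * k := Nat.floor_le (by positivity)
  have hF2 : f * k / 2 ≤ F := by
    have := Nat.lt_floor_add_one (f * k)
    rw [← hF] at this
    linarith
  have hs0 : 0 < s := by
    have : (0 : ℝ) < s := by linarith
    exact_mod_cast this
  have hF0 : 0 < F := by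
    have : (0 : ℝ) < F := by linarith
    exact_mod_cast this
  have hmC : (numIdx c k : ℝ) ≤ C * k := by exact_mod_cast hm
  have hAs : A ^ s ≤ r ^ k := hpow k s (hs1.trans (by gcongr))
  have hle : ∀ z : ℝ, 0 ≤ z → z ≤ A → z ^ s ≤ r ^ k := fun z hz hzA => (pow_le_pow_left₀ hz hzA s).trans hAs
  have h2s : (2 : ℝ) ^ s ≤ r ^ k := hle 2 (by norm_num) (by rw [hA]; linarith)
  have hrk : 0 < r ^ k := by positivity
  have hinvs : ∀ z : ℝ, 0 < z → 1 / z ≤ A → 1 / r ^ k ≤ z ^ s := fun z hz hzA => by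
    have h1 := hle (1 / z) (by positivity) hzA
    rw [div_pow, one_pow, div_le_iff₀ (by positivity)] at h1
    rw [div_le_iff₀ hrk]; linarith
  have hρ1 : 1 < r ^ k := one_lt_pow₀ hr (by omega)
  have hSpos : (0 : ℝ) < S.card := lt_of_lt_of_le (by positivity) hSc
  have hρ3 : (r ^ k) ^ 3 ≤ (S.card : ℝ) := by
    refine le_trans ?_ hSc
    rw [← pow_mul, mul_comm, pow_mul]
    exact pow_le_pow_left₀ (by positivity) hr43 k
  have hρ10 : (r ^ k) ^ 10 ≤ b ^ k := by
    rw [← pow_mul, mul_comm, pow_mul]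
    exact pow_le_pow_left₀ (by positivity) hrb k
  have h2m : 2 * (numIdx c k : ℝ) < r ^ k := by
    have := hK2 k hkK2
    linarith
  obtain ⟨g1, g2, g3⟩ := CLB.arith (r ^ k) S.card (b ^ k) (numIdx c k) (α ^ s) (2 ^ s) (δ ^ s) hρ1 hρ3 hρ10
    (by positivity) h2m (hinvs α hα (by rw [hA]; linarith)) (by positivity) h2s (hinvs δ hδ (by rw [hA]; linarith))
  have h1k : (1 - α) ^ k = 1 / r ^ k := by rw [hα', div_pow, one_pow]
  have hb0 : 0 < b := by linarith
  refine CLB.core c k G R S δ (S.card / b ^ k) α κ (S.card / (2 * (r ^ k) ^ 4)) s F hk1 hs0 hF0 hδ hδ1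
    (by positivity) hα hα1 hκ hκ1 (by positivity) ?_ ?_ ?_ hdens (r ^ k) ?_ ?_ g2 ?_
  · have h1 : (4 : ℝ) * k * F ≤ s * s := by
      calc (4 : ℝ) * k * F ≤ 4 * k * (f * k) := by gcongr
        _ = (ε * k / 2) * (ε * k / 2) := by rw [hf]; ring
        _ ≤ s * s := by gcongr
    exact_mod_cast h1
  · refine le_trans ?_ hF2
    calc κ * numIdx c k ≤ κ * (C * k) := by gcongr
      _ = f * k / 2 := by rw [hκdef]; field_simp
  · refine CLB.len_small (1 - κ) (ε * f / 4 * k ^ 2) _ (s * F) ht1 (by linarith) ?_ ?_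
    · push_cast
      calc ε * f / 4 * (k : ℝ) ^ 2 = (ε * k / 2) * (f * k / 2) := by ring
        _ ≤ s * F := by gcongr
    · rw [← mul_assoc]; exact hL
  · have := hfew (Finset.univ : Finset (Fin k)) s (by
      rw [Finset.card_univ, Fintype.card_fin]; exact hs1.trans (by gcongr))
    rw [Finset.card_univ, Fintype.card_fin] at this
    exact this
  · rw [h1k]; exact g1
  · rw [h1k]; exact g3
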